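/- Let H be a signed graph such that |E_N(H)| ≥ 2 and H − E_N(H) is a spanning tree of H. Then H has a signed circuit {0,1,2,3}-cover such that each edge of B_s(H) ∪ (∪_{e ∈ E_N(H)} S_H(e)) is covered at least once and each negative loop of H (if any) is covered exactly twice. -/

import Mathlib

open scoped Classical

noncomputable section

/-- A signed (multi)graph: a finite multigraph (loops and multiple edges allowed)
together with a sign on each edge (`neg e = true` means `e` is negative). -/
structure SignedMultigraph where
  V : Type
  E : Type
  [fintypeV : Fintype V]
  [fintypeE : Fintype E]
  ends : E → Sym2 V
  neg : E → Bool

attribute [instance] SignedMultigraph.fintypeV SignedMultigraph.fintypeE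

namespace SignedMultigraph

variable (G : SignedMultigraph)

/-- The vertices incident with at least one edge of `S`. -/
def support (S : Finset G.E) : Finset G.V :=
  Finset.univ.filter fun v => ∃ e ∈ S, v ∈ G.ends e

/-- Degree of `v` in the edge set `S`; loops count twice. -/
def degIn (S : Finset G.E) (v : G.V) : ℕ :=
  ∑ e ∈ S, (if G.ends e = Sym2.diag v then 2 else if v ∈ G.ends e then 1 else 0)

/-- `u` and `v` are joined by an edge of `S`. -/
def Adj (S : Finset G.E) (u v : G.V) : Prop := ∃ e ∈ S, G.ends e = s(u, v)

/-- Reachability using only edges of `S`. -/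
def Reach (S : Finset G.E) : G.V → G.V → Prop := Relation.ReflTransGen (G.Adj S)

/-- The subgraph with edge set `S` (and vertex set its support) is connected. -/
def ConnOn (S : Finset G.E) : Prop :=
  ∀ u ∈ G.support S, ∀ v ∈ G.support S, G.Reach S u v

/-- The whole signed graph is connected. -/
def Connected : Prop := Nonempty G.V ∧ ∀ u v : G.V, G.Reach Finset.univ u v

/-- The negative edges among `S`. -/
def negEdges (S : Finset G.E) : Finset G.E := S.filter fun e => G.neg e = true

/-- A circuit: a (nonempty) connected 2-regular subgraph, given by its edge set. -/
def IsCircuit (S : Finset G.E) : Prop :=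
  S.Nonempty ∧ G.ConnOn S ∧ ∀ v ∈ G.support S, G.degIn S v = 2

/-- A balanced circuit: a circuit with an even number of negative edges. -/
def IsBalancedCircuit (S : Finset G.E) : Prop :=
  G.IsCircuit S ∧ Even (G.negEdges S).card

/-- An unbalanced circuit: a circuit with an odd number of negative edges. -/
def IsUnbalancedCircuit (S : Finset G.E) : Prop :=
  G.IsCircuit S ∧ ¬ Even (G.negEdges S).card

/-- A short barbell: two unbalanced circuits meeting at exactly one vertex. -/
def IsShortBarbell (S : Finset G.E) : Prop :=
  ∃ C₁ C₂ : Finset G.E, G.IsUnbalancedCircuit C₁ ∧ G.IsUnbalancedCircuit C₂ ∧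
    Disjoint C₁ C₂ ∧ (G.support C₁ ∩ G.support C₂).card = 1 ∧ S = C₁ ∪ C₂

/-- A path with (distinct) ends `u` and `v`, given by its edge set. -/
def IsPath (P : Finset G.E) (u v : G.V) : Prop :=
  P.Nonempty ∧ G.ConnOn P ∧ u ≠ v ∧ u ∈ G.support P ∧ v ∈ G.support P ∧
    G.degIn P u = 1 ∧ G.degIn P v = 1 ∧
    ∀ w ∈ G.support P, w ≠ u → w ≠ v → G.degIn P w = 2

/-- A long barbell: two vertex-disjoint unbalanced circuits joined by a path
meeting the circuits only at its ends. -/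
def IsLongBarbell (S : Finset G.E) : Prop :=
  ∃ (C₁ C₂ P : Finset G.E) (u v : G.V),
    G.IsUnbalancedCircuit C₁ ∧ G.IsUnbalancedCircuit C₂ ∧
    Disjoint (G.support C₁) (G.support C₂) ∧
    G.IsPath P u v ∧
    G.support P ∩ G.support C₁ = {u} ∧ G.support P ∩ G.support C₂ = {v} ∧
    Disjoint P C₁ ∧ Disjoint P C₂ ∧
    S = C₁ ∪ C₂ ∪ P

/-- A signed circuit: a balanced circuit, a short barbell, or a long barbell. -/
def IsSignedCircuit (S : Finset G.E) : Prop :=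
  G.IsBalancedCircuit S ∨ G.IsShortBarbell S ∨ G.IsLongBarbell S

/-- The number of members of the family `F` containing the edge `e`. -/
def coverCount (F : Multiset (Finset G.E)) (e : G.E) : ℕ :=
  (F.filter fun S => e ∈ S).card

/-- The total length of the family `F`. -/
def coverLength (F : Multiset (Finset G.E)) : ℕ := (F.map Finset.card).sum

/-- A signed circuit cover: every edge is in at least one member. -/
def IsSignedCircuitCover (F : Multiset (Finset G.E)) : Prop :=
  (∀ S ∈ F, G.IsSignedCircuit S) ∧ ∀ e : G.E, 1 ≤ G.coverCount F e

/-- The length of a shortest signed circuit cover. -/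
def SCC : ℕ := sInf { n | ∃ F, G.IsSignedCircuitCover F ∧ G.coverLength F = n }

/-- Whether edge `e` has exactly one endpoint in the vertex set `A`. -/
def crossesB (A : Finset G.V) (e : G.E) : Bool :=
  Sym2.lift ⟨fun x y => Bool.xor (decide (x ∈ A)) (decide (y ∈ A)),
    fun x y => Bool.xor_comm _ _⟩ (G.ends e)

/-- Sign of `e` (`true` = negative) after switching at every vertex of `A`. -/
def negAfter (A : Finset G.V) (e : G.E) : Bool :=
  Bool.xor (G.neg e) (G.crossesB A e)

/-- Minimum number of negative edges in `S` over all switchings. -/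
def negOf (S : Finset G.E) : ℕ :=
  sInf { n | ∃ A : Finset G.V, (S.filter fun e => G.negAfter A e = true).card = n }

/-- The negativeness of `G`. -/
def negativeness : ℕ := G.negOf Finset.univ

/-- The edges of `S` with exactly one endpoint in `U`: the edge boundary `δ(U)` inside `S`. -/
def boundary (S : Finset G.E) (U : Finset G.V) : Finset G.E :=
  S.filter fun e => G.crossesB U e = true

/-- `b` is a bridge of the subgraph with edge set `S`. -/
def IsBridge (S : Finset G.E) (b : G.E) : Prop :=
  ∃ U : Finset G.V, G.boundary S U = {b}

/-- The subgraph with edge set `S` is bridgeless. -/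
def Bridgeless (S : Finset G.E) : Prop := ∀ b ∈ S, ¬ G.IsBridge S b

/-- `G` is 2-edge-connected. -/
def TwoEdgeConnected : Prop :=
  G.Connected ∧ ∀ b : G.E, ¬ G.IsBridge Finset.univ b

/-- Edges of `S` lying in the same component (of the subgraph with edge set `S`)
as the vertex `x`. -/
def compEdges (S : Finset G.E) (x : G.V) : Finset G.E :=
  S.filter fun e => ∃ u, u ∈ G.ends e ∧ G.Reach S x u

/-- A g-bridge: a bridge such that both components of `G - b` have even negativeness. -/
def IsGBridge (b : G.E) : Prop :=
  G.IsBridge Finset.univ b ∧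
    ∃ x y : G.V, G.ends b = s(x, y) ∧
      Even (G.negOf (G.compEdges (Finset.univ.erase b) x)) ∧
      Even (G.negOf (G.compEdges (Finset.univ.erase b) y))

/-- `G` has no g-bridge (in any of its components). -/
def GBridgeless : Prop := ∀ b : G.E, ¬ G.IsGBridge b

/-- Member of `B_g(G)`: a bridge such that at least one component of `G - b`
contains an odd number of negative edges. -/
def IsBgBridge (b : G.E) : Prop :=
  G.IsBridge Finset.univ b ∧
    ∃ x : G.V, x ∈ G.ends b ∧
      ¬ Even (G.negEdges (G.compEdges (Finset.univ.erase b) x)).card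

/-- Member of `B_s(G)`: a bridge such that each of the two components of `G - b`
contains a negative edge. -/
def IsSBridge (b : G.E) : Prop :=
  G.IsBridge Finset.univ b ∧
    ∃ x y : G.V, G.ends b = s(x, y) ∧
      (G.negEdges (G.compEdges (Finset.univ.erase b) x)).Nonempty ∧
      (G.negEdges (G.compEdges (Finset.univ.erase b) y)).Nonempty

/-- `G` is s-bridgeless: every edge lies in some signed circuit. -/
def SBridgeless : Prop := ∀ e : G.E, ∃ S : Finset G.E, G.IsSignedCircuit S ∧ e ∈ S

/-- `{e, f}` is a 2-edge-cut of `G`. -/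
def IsTwoEdgeCut (e f : G.E) : Prop :=
  e ≠ f ∧ ∃ U : Finset G.V, G.boundary Finset.univ U = {e, f}

/-- `S_G(e) = {e} ∪ {f : {e,f} is a 2-edge-cut of G}`. -/
def SSet (e : G.E) : Finset G.E :=
  insert e (Finset.univ.filter fun f => G.IsTwoEdgeCut e f)

/-- The edge set `R` spans an acyclic subgraph (every nonempty subset has a
vertex of degree one). -/
def AcyclicSet (R : Finset G.E) : Prop :=
  ∀ F ⊆ R, F.Nonempty → ∃ v : G.V, G.degIn F v = 1

/-- `T` is the edge set of a spanning tree of `G`. -/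
def IsSpanningTree (T : Finset G.E) : Prop :=
  G.AcyclicSet T ∧ Nonempty G.V ∧ ∀ u v : G.V, G.Reach T u v

/-- `G` is eulerian: connected with all degrees even. -/
def Eulerian : Prop :=
  G.Connected ∧ ∀ v : G.V, Even (G.degIn Finset.univ v)

/-- The edge set `S` spans an eulerian subgraph. -/
def IsEulerianSub (S : Finset G.E) : Prop :=
  S.Nonempty ∧ G.ConnOn S ∧ ∀ v ∈ G.support S, Even (G.degIn S v)

/-- The vertex class of `v` after contracting each member of `ℬ`. -/
def classOf (ℬ : Finset (Finset G.E)) (v : G.V) : Finset G.V :=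
  Finset.univ.filter fun u => u = v ∨ ∃ B ∈ ℬ, v ∈ G.support B ∧ u ∈ G.support B

/-- Degree, in edge set `F`, of the contracted class of `v`. -/
def classDeg (ℬ : Finset (Finset G.E)) (F : Finset G.E) (v : G.V) : ℕ :=
  ∑ u ∈ G.classOf ℬ v, G.degIn F u

/-- `ℬ` witnesses that the subgraph with edge set `S` is a generalized barbell:
`ℬ` is a family of vertex-disjoint eulerian subgraphs of `S`, the contraction
`S/(∪ℬ)` is acyclic, and for every vertex `x` of the contracted graph,
`|E_N(B_x)| ≡ |δ(V(B_x))| (mod 2)`. -/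
def GenBarbellWitness (S : Finset G.E) (ℬ : Finset (Finset G.E)) : Prop :=
  (∀ B ∈ ℬ, B ⊆ S ∧ G.IsEulerianSub B) ∧
  (∀ B₁ ∈ ℬ, ∀ B₂ ∈ ℬ, B₁ ≠ B₂ → Disjoint (G.support B₁) (G.support B₂)) ∧
  (∀ F ⊆ S \ ℬ.sup id, F.Nonempty → ∃ v : G.V, G.classDeg ℬ F v = 1) ∧
  (∀ B ∈ ℬ, (G.negEdges B).card ≡ (G.boundary S (G.support B)).card [MOD 2]) ∧
  (∀ v ∈ G.support S, (∀ B ∈ ℬ, v ∉ G.support B) → Even (G.boundary S {v}).card)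

/-- The subgraph with edge set `S` is a generalized barbell. -/
def IsGenBarbell (S : Finset G.E) : Prop := ∃ ℬ, G.GenBarbellWitness S ℬ


variable {G}

/-- Number of ends of the edge `e` at the vertex `v`. -/
def inc (e : G.E) (v : G.V) : ℕ :=
  if G.ends e = Sym2.diag v then 2 else if v ∈ G.ends e then 1 else 0

theorem degIn_eq_sum_inc (S : Finset G.E) (v : G.V) : G.degIn S v = ∑ e ∈ S, inc e v := rfl

theorem exists_ends (e : G.E) : ∃ a b, G.ends e = s(a, b) := by
  induction h : G.ends e with
  | _ a b => exact ⟨a, b, rfl⟩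

theorem inc_eq {e : G.E} {a b : G.V} (h : G.ends e = s(a, b)) (v : G.V) :
    inc e v = (if v = a then 1 else 0) + (if v = b then 1 else 0) := by
  unfold inc
  have h1 : s(a, b) = Sym2.diag v ↔ a = v ∧ b = v := by
    rw [Sym2.diag, Sym2.eq_iff]; tauto
  simp only [h, Sym2.mem_iff, h1]
  by_cases h2 : v = a <;> by_cases h3 : v = b <;> grind

theorem mem_support {S : Finset G.E} {v : G.V} : v ∈ G.support S ↔ ∃ e ∈ S, v ∈ G.ends e := by
  simp [support]

theorem support_mono {S S' : Finset G.E} (h : S ⊆ S') : G.support S ⊆ G.support S' := by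
  intro v; simp only [mem_support]; rintro ⟨e, he, hv⟩; exact ⟨e, h he, hv⟩

theorem support_union (S S' : Finset G.E) :
    G.support (S ∪ S') = G.support S ∪ G.support S' := by
  ext v; simp only [mem_support, Finset.mem_union]; grind

theorem inc_eq_zero_iff {e : G.E} {v : G.V} : inc e v = 0 ↔ v ∉ G.ends e := by
  obtain ⟨a, b, h⟩ := exists_ends e
  rw [inc_eq h, h, Sym2.mem_iff]
  by_cases h2 : v = a <;> by_cases h3 : v = b <;> simp [h2, h3]

theorem degIn_eq_zero {S : Finset G.E} {v : G.V} : G.degIn S v = 0 ↔ v ∉ G.support S := by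
  rw [degIn_eq_sum_inc, Finset.sum_eq_zero_iff, mem_support]
  simp [inc_eq_zero_iff]

theorem degIn_insert {S : Finset G.E} {e : G.E} (he : e ∉ S) (v : G.V) :
    G.degIn (insert e S) v = inc e v + G.degIn S v := by
  rw [degIn_eq_sum_inc, Finset.sum_insert he, degIn_eq_sum_inc]

theorem degIn_union {S S' : Finset G.E} (h : Disjoint S S') (v : G.V) :
    G.degIn (S ∪ S') v = G.degIn S v + G.degIn S' v := by
  rw [degIn_eq_sum_inc, Finset.sum_union h]; rfl

theorem degIn_mono {S S' : Finset G.E} (h : S ⊆ S') (v : G.V) :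
    G.degIn S v ≤ G.degIn S' v := by
  simp only [degIn_eq_sum_inc]
  exact Finset.sum_le_sum_of_subset h

/-! ### Parities of degrees -/

/-- Degree parity. -/
def par (S : Finset G.E) (v : G.V) : ZMod 2 := (G.degIn S v : ZMod 2)

theorem sum_symmDiff {ι : Type} [Fintype ι] (f : ι → ZMod 2) (A B : Finset ι) :
    ∑ e ∈ symmDiff A B, f e = ∑ e ∈ A, f e + ∑ e ∈ B, f e := by
  have key : ∀ S : Finset ι, ∑ e ∈ S, f e = ∑ e, if e ∈ S then f e else 0 := by
    intro S; simp
  rw [key, key A, key B, ← Finset.sum_add_distrib]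
  refine Finset.sum_congr rfl fun e _ => ?_
  have := CharTwo.add_self_eq_zero (f e)
  by_cases ha : e ∈ A <;> by_cases hb : e ∈ B <;> simp [Finset.mem_symmDiff, ha, hb, this]

theorem par_symmDiff (A B : Finset G.E) (v : G.V) :
    par (symmDiff A B) v = par A v + par B v := by
  simp only [par, degIn_eq_sum_inc, Nat.cast_sum]
  exact sum_symmDiff _ A B

theorem par_union {A B : Finset G.E} (h : Disjoint A B) (v : G.V) :
    par (A ∪ B) v = par A v + par B v := by
  simp [par, degIn_union h]

theorem par_sdiff {A B : Finset G.E} (h : B ⊆ A) (v : G.V) :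
    par (A \ B) v = par A v + par B v := by
  have := par_union (G := G) (Finset.sdiff_disjoint (s := B) (t := A)) v
  rw [Finset.sdiff_union_of_subset h] at this
  rw [this, add_assoc, CharTwo.add_self_eq_zero, add_zero]

theorem crossesB_eq {e : G.E} {a b : G.V} (h : G.ends e = s(a, b)) (U : Finset G.V) :
    G.crossesB U e = Bool.xor (decide (a ∈ U)) (decide (b ∈ U)) := by
  simp [crossesB, h]

theorem mem_boundary {S : Finset G.E} {U : Finset G.V} {e : G.E} :
    e ∈ G.boundary S U ↔ e ∈ S ∧ G.crossesB U e = true := by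
  simp [boundary]

theorem sum_par (S : Finset G.E) (U : Finset G.V) :
    ∑ v ∈ U, par S v = ((G.boundary S U).card : ZMod 2) := by
  simp only [par, degIn_eq_sum_inc, Nat.cast_sum]
  rw [Finset.sum_comm, boundary, Finset.card_filter, Nat.cast_sum]
  refine Finset.sum_congr rfl fun e _ => ?_
  obtain ⟨a, b, h⟩ := exists_ends e
  rw [crossesB_eq h]
  simp only [inc_eq h]
  push_cast
  rw [Finset.sum_add_distrib, Finset.sum_ite_eq', Finset.sum_ite_eq']
  by_cases ha : a ∈ U <;> by_cases hb : b ∈ U <;> simp [ha, hb]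
  decide

theorem zmod_two_cases (x : ZMod 2) : x = 0 ∨ x = 1 := by
  revert x; decide

/-! ### Reachability -/

theorem Reach.symm {S : Finset G.E} {u v : G.V} (h : G.Reach S u v) : G.Reach S v u := by
  induction h with
  | refl => exact .refl
  | tail _ h ih =>
    obtain ⟨e, he, hs⟩ := h
    exact .head ⟨e, he, by rw [hs, Sym2.eq_swap]⟩ ih

theorem Reach.mono {S S' : Finset G.E} (h : S ⊆ S') {u v : G.V} (huv : G.Reach S u v) :
    G.Reach S' u v :=
  Relation.ReflTransGen.mono (r := G.Adj S) (p := G.Adj S')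
    (fun _ _ ⟨e, he, hs⟩ => ⟨e, h he, hs⟩) _ _ huv

theorem reach_cross {S : Finset G.E} {U : Finset G.V} {u v : G.V} (h : G.Reach S u v)
    (hu : u ∈ U) (hv : v ∉ U) : ∃ e ∈ S, ∃ x y, G.ends e = s(x, y) ∧ x ∈ U ∧ y ∉ U := by
  induction h with
  | refl => exact absurd hu hv
  | @tail b c _ h ih =>
    by_cases hb : b ∈ U
    · obtain ⟨e, he, hs⟩ := h
      exact ⟨e, he, b, c, hs, hb, hv⟩
    · exact ih hb

theorem reach_boundary {S : Finset G.E} {U : Finset G.V} {u v : G.V} (h : G.Reach S u v)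
    (hne : ¬ (u ∈ U ↔ v ∈ U)) : ∃ e ∈ S, G.crossesB U e = true := by
  wlog hu : u ∈ U generalizing u v
  · exact this h.symm (by tauto) (by tauto)
  obtain ⟨e, he, x, y, hs, hx, hy⟩ := reach_cross h hu (by tauto)
  exact ⟨e, he, by simp [crossesB_eq hs, hx, hy]⟩

theorem connOn_cross {S : Finset G.E} (hS : G.ConnOn S) {U : Finset G.V} {u v : G.V}
    (hu : u ∈ G.support S) (hv : v ∈ G.support S) (hne : ¬ (u ∈ U ↔ v ∈ U)) :
    ∃ e ∈ S, G.crossesB U e = true :=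
  reach_boundary (hS u hu v hv) hne

theorem reach_of_par {J : Finset G.E} {x : G.V} (hx : par J x = 1) :
    ∃ y, y ≠ x ∧ G.Reach J x y ∧ par J y = 1 := by
  by_contra! hcon
  let U : Finset G.V := Finset.univ.filter fun v => G.Reach J x v
  have hb : G.boundary J U = ∅ := by
    rw [Finset.eq_empty_iff_forall_notMem]
    intro e he
    obtain ⟨heJ, hc⟩ := mem_boundary.1 he
    obtain ⟨a, b, h⟩ := exists_ends e
    have hab : a ∈ U ↔ b ∈ U := by
      simp only [U, Finset.mem_filter, Finset.mem_univ, true_and]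
      exact ⟨fun h' => h'.tail ⟨e, heJ, h⟩, fun h' => h'.tail ⟨e, heJ, by rw [h, Sym2.eq_swap]⟩⟩
    rw [crossesB_eq h] at hc
    simp [hab] at hc
  have hs := sum_par J U
  rw [hb, Finset.sum_eq_single x] at hs
  · simp [hx] at hs
  · intro y hy hyx
    simp only [U, Finset.mem_filter, Finset.mem_univ, true_and] at hy
    exact (zmod_two_cases _).resolve_right (hcon y hyx hy)
  · intro h
    have hxx : G.Reach J x x := Relation.ReflTransGen.refl
    simp [U, hxx] at h

theorem connOn_of_reach {S : Finset G.E} {x : G.V} (h : ∀ v ∈ G.support S, G.Reach S x v) :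
    G.ConnOn S :=
  fun u hu v hv => (h u hu).symm.trans (h v hv)

theorem connOn_union {A B : Finset G.E} (hA : G.ConnOn A) (hB : G.ConnOn B) {x : G.V}
    (hxA : x ∈ G.support A) (hxB : x ∈ G.support B) : G.ConnOn (A ∪ B) := by
  refine connOn_of_reach (x := x) fun v hv => ?_
  rw [support_union, Finset.mem_union] at hv
  rcases hv with hv | hv
  · exact (hA x hxA v hv).mono Finset.subset_union_left
  · exact (hB x hxB v hv).mono Finset.subset_union_right

/-! ### Simple paths -/

/-- `SPath Q x P z`: `P ⊆ Q` is the edge set of a simple path from `x` to `z`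
(empty when `x = z`). -/
inductive SPath (Q : Finset G.E) : G.V → Finset G.E → G.V → Prop
  | nil (x : G.V) : SPath Q x ∅ x
  | cons {e : G.E} {x y z : G.V} {P : Finset G.E} (he : e ∈ Q) (hs : G.ends e = s(x, y))
      (hP : SPath Q y P z) (hx : x ∉ G.support P) (hxz : x ≠ z) : SPath Q x (insert e P) z

theorem support_insert {e : G.E} {x y : G.V} (h : G.ends e = s(x, y)) (S : Finset G.E) :
    G.support (insert e S) = insert x (insert y (G.support S)) := by
  ext v
  simp only [mem_support, Finset.mem_insert, exists_eq_or_imp, h, Sym2.mem_iff, or_assoc]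

theorem support_empty : G.support (∅ : Finset G.E) = ∅ := by
  ext v; simp [mem_support]

namespace SPath

variable {Q P : Finset G.E} {x y z v : G.V}

theorem subset (h : SPath Q x P z) : P ⊆ Q := by
  induction h with
  | nil => simp
  | cons he _ _ _ _ ih => exact Finset.insert_subset he ih

theorem ne_of_notMem (h : SPath Q y P z) (hx : x ∉ G.support P) (hxz : x ≠ z) : x ≠ y := by
  cases h with
  | nil => exact hxz
  | cons he hs hP _ _ =>
    rintro rfl
    exact hx (by simp [support_insert hs])

theorem mem_support_of_ne (h : SPath Q x P z) (hxz : x ≠ z) :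
    x ∈ G.support P ∧ z ∈ G.support P := by
  induction h with
  | nil => exact absurd rfl hxz
  | @cons e x y z P he hs hP hx hxz' ih =>
    rw [support_insert hs]
    refine ⟨by simp, ?_⟩
    by_cases hyz : y = z
    · simp [hyz]
    · simp [(ih hyz).2]

theorem degIn_add (h : SPath Q x P z) (v : G.V) :
    G.degIn P v + (if v = x then 1 else 0) + (if v = z then 1 else 0) =
      if v ∈ G.support P ∨ v = x ∨ v = z then 2 else 0 := by
  induction h with
  | nil x =>
    have : ∀ w, G.degIn ∅ w = 0 := fun w => by rw [degIn_eq_zero]; simp [support_empty]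
    by_cases hv : v = x <;> simp [this, support_empty, hv]
  | @cons e x y z P he hs hP hx hxz ih =>
    have heP : e ∉ P := fun h => hx (mem_support.2 ⟨e, h, by simp [hs]⟩)
    have hxy := hP.ne_of_notMem hx hxz
    rw [degIn_insert heP, inc_eq hs, support_insert hs]
    simp only [Finset.mem_insert]
    by_cases hvx : v = x
    · subst hvx
      have : G.degIn P v = 0 := degIn_eq_zero.2 hx
      simp [this, hxy, hxz]
    · simp only [hvx, if_false, false_or, add_zero, zero_add]
      have h : (v = y ∨ v ∈ G.support P) ∨ v = z ↔ v ∈ G.support P ∨ v = y ∨ v = z := by tauto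
      simp only [h]
      rw [← ih]
      ring

theorem degIn_eq_two (h : SPath Q x P z) (hv : v ∈ G.support P) (hvx : v ≠ x) (hvz : v ≠ z) :
    G.degIn P v = 2 := by
  simpa [hv, hvx, hvz] using h.degIn_add v

theorem degIn_left (h : SPath Q x P z) (hxz : x ≠ z) : G.degIn P x = 1 := by
  have := h.degIn_add x
  simp [hxz] at this
  omega

theorem degIn_right (h : SPath Q x P z) (hxz : x ≠ z) : G.degIn P z = 1 := by
  have := h.degIn_add z
  simp [hxz.symm] at this
  omega

theorem par_eq (h : SPath Q x P z) (v : G.V) :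
    par P v = (if v = x then 1 else 0) + (if v = z then 1 else 0) := by
  have := congrArg (Nat.cast (R := ZMod 2)) (h.degIn_add v)
  push_cast at this
  have h2 : (if v ∈ G.support P ∨ v = x ∨ v = z then (2 : ZMod 2) else 0) = 0 := by
    split_ifs
    · decide
    · rfl
  rw [h2, add_assoc] at this
  exact CharTwo.add_eq_zero.1 this

theorem reach (h : SPath Q x P z) : ∀ v ∈ G.support P, G.Reach P x v := by
  induction h with
  | nil => simp [support_empty]
  | @cons e x y z P he hs hP hx hxz ih =>
    intro v hv
    rw [support_insert hs, Finset.mem_insert, Finset.mem_insert] at hv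
    have hxy : G.Reach (insert e P) x y := .single ⟨e, by simp, hs⟩
    rcases hv with rfl | rfl | hv
    · exact .refl
    · exact hxy
    · exact hxy.trans ((ih v hv).mono (Finset.subset_insert _ _))

theorem connOn (h : SPath Q x P z) : G.ConnOn P := connOn_of_reach h.reach

theorem not_isDiag (h : SPath Q x P z) : ∀ e ∈ P, ¬ (G.ends e).IsDiag := by
  induction h with
  | nil => simp
  | @cons e x y z P he hs hP hx hxz ih =>
    intro f hf
    rcases Finset.mem_insert.1 hf with rfl | hf
    · rw [hs, Sym2.mk_isDiag_iff]
      exact hP.ne_of_notMem hx hxz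
    · exact ih f hf

theorem isPath (h : SPath Q x P z) (hxz : x ≠ z) : G.IsPath P x z := by
  obtain ⟨h1, h2⟩ := h.mem_support_of_ne hxz
  refine ⟨?_, h.connOn, hxz, h1, h2, h.degIn_left hxz, h.degIn_right hxz,
    fun w hw hwx hwz => h.degIn_eq_two hw hwx hwz⟩
  obtain ⟨e, he, _⟩ := mem_support.1 h1
  exact ⟨e, he⟩

theorem suffix (h : SPath Q x P z) (hv : v ∈ G.support P ∨ v = x ∨ v = z) :
    ∃ P' ⊆ P, SPath Q v P' z := by
  induction h with
  | nil x =>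
    obtain rfl : v = x := by simpa [support_empty] using hv
    exact ⟨∅, by simp, .nil _⟩
  | @cons e x y z P he hs hP hx hxz ih =>
    by_cases hvx : v = x
    · subst hvx
      exact ⟨_, subset_rfl, .cons he hs hP hx hxz⟩
    · obtain ⟨P', h1, h2⟩ := ih (by
        rw [support_insert hs, Finset.mem_insert, Finset.mem_insert] at hv; tauto)
      exact ⟨P', h1.trans (Finset.subset_insert _ _), h2⟩

theorem pfx (h : SPath Q x P z) (hv : v ∈ G.support P ∨ v = x ∨ v = z) :
    ∃ P' ⊆ P, SPath Q x P' v := by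
  induction h with
  | nil x =>
    obtain rfl : v = x := by simpa [support_empty] using hv
    exact ⟨∅, by simp, .nil _⟩
  | @cons e x y z P he hs hP hx hxz ih =>
    by_cases hvx : v = x
    · subst hvx
      exact ⟨∅, by simp, .nil _⟩
    · obtain ⟨P', h1, h2⟩ := ih (by
        rw [support_insert hs, Finset.mem_insert, Finset.mem_insert] at hv; tauto)
      exact ⟨insert e P', Finset.insert_subset_insert _ h1,
        .cons he hs h2 (fun h => hx (support_mono h1 h)) (Ne.symm hvx)⟩

theorem disjoint_side {U : Finset G.V} {b : G.E} (h : SPath Q x P z)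
    (hU : G.boundary Finset.univ U = {b}) (hx : x ∉ U) (hz : z ∉ U) :
    Disjoint (G.support P) U := by
  rw [Finset.disjoint_left]
  intro w hw hwU
  have h0 : ∑ v ∈ U, par P v = 0 := Finset.sum_eq_zero fun v hv => by
    rw [h.par_eq, if_neg (by rintro rfl; exact hx hv), if_neg (by rintro rfl; exact hz hv), add_zero]
  rw [sum_par, ZMod.natCast_eq_zero_iff] at h0
  have hsub : G.boundary P U ⊆ {b} := by
    rw [← hU]
    exact Finset.filter_subset_filter _ (Finset.subset_univ _)
  have hle := Finset.card_le_card hsub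
  rw [Finset.card_singleton] at hle
  have hz : G.boundary P U = ∅ := by rw [← Finset.card_eq_zero]; omega
  obtain ⟨e, he, hc⟩ := reach_boundary (h.reach w hw) (U := U) (by tauto)
  have := mem_boundary.2 ⟨he, hc⟩
  simp [hz] at this

end SPath

theorem exists_sPath {Q : Finset G.E} {x y : G.V} (h : G.Reach Q x y) : ∃ P, SPath Q x P y := by
  induction h using Relation.ReflTransGen.head_induction_on with
  | refl => exact ⟨∅, .nil _⟩
  | @head a c hac _ ih =>
    obtain ⟨e, he, hs⟩ := hac
    obtain ⟨P, hP⟩ := ih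
    by_cases ha : a ∈ G.support P ∨ a = c ∨ a = y
    · obtain ⟨P', _, h'⟩ := hP.suffix ha
      exact ⟨P', h'⟩
    · exact ⟨_, .cons he hs hP (by tauto) (by tauto)⟩

/-- A shortest path between two classes of vertices meets them only at its ends. -/
theorem exists_link {Q : Finset G.E} (A B : G.V → Prop)
    (h : ∃ x y, x ≠ y ∧ A x ∧ B y ∧ G.Reach Q x y) :
    ∃ x P y, SPath Q x P y ∧ x ≠ y ∧ A x ∧ B y ∧
      ∀ w ∈ G.support P, w ≠ x → w ≠ y → ¬ A w ∧ ¬ B w := by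
  have hex : ∃ n : ℕ, ∃ x P y, SPath Q x P y ∧ x ≠ y ∧ A x ∧ B y ∧ P.card = n := by
    obtain ⟨x, y, hne, hx, hy, hr⟩ := h
    obtain ⟨P, hP⟩ := exists_sPath hr
    exact ⟨_, x, P, y, hP, hne, hx, hy, rfl⟩
  obtain ⟨x, P, y, hP, hne, hx, hy, hn⟩ := Nat.find_spec hex
  refine ⟨x, P, y, hP, hne, hx, hy, fun w hw hwx hwy => ⟨fun hA => ?_, fun hB => ?_⟩⟩
  · obtain ⟨P', hP', h'⟩ := hP.suffix (Or.inl hw)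
    have hlt : P'.card < P.card := by
      refine Finset.card_lt_card (lt_of_le_of_ne hP' ?_)
      rintro rfl
      have h1 := h'.degIn_left hwy
      rw [hP.degIn_eq_two hw hwx hwy] at h1
      omega
    exact Nat.find_min hex (hn ▸ hlt) ⟨w, P', y, h', hwy, hA, hy, rfl⟩
  · obtain ⟨P', hP', h'⟩ := hP.pfx (Or.inl hw)
    have hlt : P'.card < P.card := by
      refine Finset.card_lt_card (lt_of_le_of_ne hP' ?_)
      rintro rfl
      have h1 := h'.degIn_right (Ne.symm hwx)
      rw [hP.degIn_eq_two hw hwx hwy] at h1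
      omega
    exact Nat.find_min hex (hn ▸ hlt) ⟨x, P', w, h', Ne.symm hwx, hx, hB, rfl⟩

/-! ### Circuits -/

theorem isCircuit_union {Q Q' P P' : Finset G.E} {x y : G.V} (h : SPath Q x P y)
    (h' : SPath Q' x P' y) (hxy : x ≠ y) (hd : Disjoint P P')
    (hs : ∀ w ∈ G.support P, w ∈ G.support P' → w = x ∨ w = y) : G.IsCircuit (P ∪ P') := by
  obtain ⟨hx, hy⟩ := h.mem_support_of_ne hxy
  obtain ⟨hx', hy'⟩ := h'.mem_support_of_ne hxy
  refine ⟨?_, connOn_union h.connOn h'.connOn hx hx', fun v hv => ?_⟩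
  · obtain ⟨e, he, _⟩ := mem_support.1 hx
    exact ⟨e, Finset.mem_union_left _ he⟩
  rw [degIn_union hd]
  by_cases hvx : v = x
  · subst hvx; rw [h.degIn_left hxy, h'.degIn_left hxy]
  by_cases hvy : v = y
  · subst hvy; rw [h.degIn_right hxy, h'.degIn_right hxy]
  rw [support_union, Finset.mem_union] at hv
  by_cases hvP : v ∈ G.support P
  · rw [h.degIn_eq_two hvP hvx hvy, degIn_eq_zero.2 fun hc => (hs v hvP hc).elim hvx hvy]
  · rw [degIn_eq_zero.2 hvP, h'.degIn_eq_two (hv.resolve_left hvP) hvx hvy]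

namespace IsCircuit

variable {C : Finset G.E}

theorem par_eq (hC : G.IsCircuit C) (v : G.V) : par C v = 0 := by
  by_cases hv : v ∈ G.support C
  · rw [par, hC.2.2 v hv]; rfl
  · rw [par, degIn_eq_zero.2 hv]; rfl

theorem eq_of_subset (hC : G.IsCircuit C) {D : Finset G.E} (hD : D ⊆ C) (hne : D.Nonempty)
    (hpar : ∀ v, par D v = 0) : D = C := by
  have hdeg : ∀ v ∈ G.support D, G.degIn D v = G.degIn C v := by
    intro v hv
    have h1 := hpar v
    rw [par, ZMod.natCast_eq_zero_iff] at h1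
    have h2 := degIn_mono hD v
    rw [hC.2.2 v (support_mono hD hv)] at h2 ⊢
    have h3 := mt (degIn_eq_zero (S := D) (v := v)).1 (not_not.2 hv)
    omega
  have hmem : ∀ e ∈ C, ∀ v ∈ G.ends e, v ∈ G.support D → e ∈ D := by
    intro e he v hv hvD
    by_contra heD
    have h1 := degIn_union (G := G) (Finset.sdiff_disjoint (s := D) (t := C)) v
    rw [Finset.sdiff_union_of_subset hD, hdeg v hvD] at h1
    have h2 : G.degIn (C \ D) v = 0 := by omega
    exact degIn_eq_zero.1 h2 (mem_support.2 ⟨e, by simp [he, heD], hv⟩)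
  obtain ⟨d, hd⟩ := hne
  obtain ⟨a, b, hab⟩ := exists_ends d
  have haD : a ∈ G.support D := mem_support.2 ⟨d, hd, by simp [hab]⟩
  refine Finset.Subset.antisymm hD fun e he => ?_
  obtain ⟨p, q, hpq⟩ := exists_ends e
  have hpC : p ∈ G.support C := mem_support.2 ⟨e, he, by simp [hpq]⟩
  by_contra heD
  have hpD : p ∉ G.support D := fun h => heD (hmem e he p (by simp [hpq]) h)
  obtain ⟨f, hf, u, w, hs, hu, hw⟩ :=
    reach_cross (hC.2.1 a (support_mono hD haD) p hpC) haD hpD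
  exact hw (mem_support.2 ⟨f, hmem f hf u (by simp [hs]) hu, by simp [hs]⟩)

theorem even_boundary (hC : G.IsCircuit C) (U : Finset G.V) : Even (G.boundary C U).card := by
  have h := sum_par C U
  rw [Finset.sum_eq_zero fun v _ => hC.par_eq v] at h
  exact (ZMod.natCast_eq_zero_iff_even).1 h.symm

/-- A circuit lies on one side of a bridge. -/
theorem side (hC : G.IsCircuit C) {U : Finset G.V} {b : G.E}
    (hU : G.boundary Finset.univ U = {b}) : G.support C ⊆ U ∨ Disjoint (G.support C) U := by
  by_contra! h
  obtain ⟨h1, h2⟩ := h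
  obtain ⟨p, hp, hpU⟩ := Finset.not_subset.1 h1
  obtain ⟨q, hq, hqU⟩ := Finset.not_disjoint_iff.1 h2
  obtain ⟨e, he, hc⟩ := connOn_cross hC.2.1 hp hq (U := U) (by tauto)
  have hsub : G.boundary C U ⊆ {b} := by
    rw [← hU]
    exact Finset.filter_subset_filter _ (Finset.subset_univ _)
  have h3 := Finset.card_le_card hsub
  have h4 := Finset.card_pos.2 ⟨e, mem_boundary.2 ⟨he, hc⟩⟩
  have h5 := hC.even_boundary U
  rw [Finset.card_singleton] at h3
  rw [show (G.boundary C U).card = 1 by omega] at h5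
  exact absurd h5 (by decide)

end IsCircuit

theorem isCircuit_loop {e : G.E} {x : G.V} (h : G.ends e = s(x, x)) : G.IsCircuit {e} := by
  have hs : G.support {e} = {x} := by
    ext v; simp [mem_support, h]
  refine ⟨by simp, fun u hu v hv => ?_, fun v hv => ?_⟩
  · rw [hs, Finset.mem_singleton] at hu hv
    subst hu; subst hv; exact .refl
  · rw [hs, Finset.mem_singleton] at hv
    subst hv
    rw [degIn_eq_sum_inc, Finset.sum_singleton, inc_eq h]; simp

theorem IsCircuit.eq_loop {C : Finset G.E} (hC : G.IsCircuit C) {e : G.E} (he : e ∈ C)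
    (hd : (G.ends e).IsDiag) : C = {e} := by
  obtain ⟨a, b, h⟩ := exists_ends e
  rw [h, Sym2.mk_isDiag_iff] at hd
  subst hd
  exact (hC.eq_of_subset (by simpa using he) (by simp) (isCircuit_loop h).par_eq).symm

theorem exists_sPath_erase {Z : Finset G.E} (hZ : ∀ v, par Z v = 0) {e : G.E} (he : e ∈ Z)
    {x y : G.V} (h : G.ends e = s(x, y)) (hxy : x ≠ y) : ∃ P, SPath (Z.erase e) y P x := by
  have hpe : ∀ v, par (Z.erase e) v = (if v = x then 1 else 0) + (if v = y then 1 else 0) := by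
    intro v
    rw [← Finset.sdiff_singleton_eq_erase, par_sdiff (by simpa using he), hZ, zero_add]
    simp [par, degIn_eq_sum_inc, inc_eq h]
  obtain ⟨z, hzy, hr, hz⟩ := reach_of_par (J := Z.erase e) (x := y) (by simp [hpe, hxy.symm])
  have hzx : z = x := by
    by_contra hne
    simp [hpe, hne, hzy] at hz
  subst hzx
  exact exists_sPath hr

theorem sPath_single {e : G.E} {x y : G.V} (h : G.ends e = s(x, y)) (hxy : x ≠ y) :
    SPath {e} x {e} y := by
  simpa using SPath.cons (Q := {e}) (by simp) h (.nil y) (by simp [support_empty]) hxy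

/-- In an even edge set, every edge lies in a circuit. -/
theorem exists_circuit_through {Z : Finset G.E} (hZ : ∀ v, par Z v = 0) {e : G.E} (he : e ∈ Z) :
    ∃ C ⊆ Z, e ∈ C ∧ G.IsCircuit C := by
  obtain ⟨x, y, h⟩ := exists_ends e
  by_cases hxy : x = y
  · subst hxy
    exact ⟨{e}, by simpa using he, by simp, isCircuit_loop h⟩
  obtain ⟨P, hP⟩ := exists_sPath_erase hZ he h hxy
  have hPZ := hP.subset
  refine ⟨P ∪ {e}, ?_, by simp, ?_⟩
  · exact Finset.union_subset (hPZ.trans (Finset.erase_subset _ _)) (by simpa using he)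
  · refine isCircuit_union hP (sPath_single (by rw [h, Sym2.eq_swap]) (Ne.symm hxy))
      (Ne.symm hxy) ?_ ?_
    · rw [Finset.disjoint_singleton_right]
      exact fun h => by simpa using hPZ h
    · intro w _ hw
      simpa [mem_support, h, or_comm] using hw

/-! ### Decomposition of even edge sets -/

/-- Parity of the number of negative edges. -/
def npar (S : Finset G.E) : ZMod 2 := ((G.negEdges S).card : ZMod 2)

theorem npar_union {A B : Finset G.E} (h : Disjoint A B) : npar (A ∪ B) = npar A + npar B := by
  unfold npar negEdges
  rw [Finset.filter_union, Finset.card_union_of_disjoint (Finset.disjoint_filter_filter h),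
    Nat.cast_add]

theorem npar_eq_zero {S : Finset G.E} : npar S = 0 ↔ Even (G.negEdges S).card :=
  ZMod.natCast_eq_zero_iff_even

theorem npar_eq_one {S : Finset G.E} : npar S = 1 ↔ ¬ Even (G.negEdges S).card := by
  rw [← npar_eq_zero]
  generalize npar S = x
  revert x; decide

/-- Two unbalanced circuits sharing two vertices contain a balanced circuit. -/
theorem exists_balanced {D D' : Finset G.E} (hD : G.IsUnbalancedCircuit D)
    (hD' : G.IsUnbalancedCircuit D') (hd : Disjoint D D')
    (hs : 1 < (G.support D ∩ G.support D').card) :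
    ∃ B ⊆ D ∪ D', G.IsBalancedCircuit B := by
  obtain ⟨p, hp, q, hq, hpq⟩ := Finset.one_lt_card.1 hs
  rw [Finset.mem_inter] at hp hq
  obtain ⟨x, Q, y, hQ, hxy, hx, hy, hinner⟩ :=
    exists_link (Q := D') (· ∈ G.support D) (· ∈ G.support D)
      ⟨p, q, hpq, hp.1, hq.1, hD'.1.2.1 p hp.2 q hq.2⟩
  obtain ⟨P₁, h₁⟩ := exists_sPath (hD.1.2.1 x hx y hy)
  have hpar : ∀ v, par (D \ P₁) v = (if v = x then 1 else 0) + (if v = y then 1 else 0) := by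
    intro v
    rw [par_sdiff h₁.subset, hD.1.par_eq, h₁.par_eq, zero_add]
  obtain ⟨z, hzx, hr, hz⟩ := reach_of_par (J := D \ P₁) (x := x) (by simp [hpar, hxy])
  have hzy : z = y := by
    by_contra hne
    simp [hpar, hne, hzx] at hz
  subst hzy
  obtain ⟨P₂, h₂⟩ := exists_sPath hr
  have hdisj : Disjoint P₁ P₂ :=
    (Finset.disjoint_sdiff (s := P₁) (t := D)).mono_right h₂.subset
  have hsub₂ : P₂ ⊆ D := h₂.subset.trans Finset.sdiff_subset
  have hunion : P₁ ∪ P₂ = D := by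
    refine hD.1.eq_of_subset (Finset.union_subset h₁.subset hsub₂) ?_ fun v => ?_
    · obtain ⟨e, he, _⟩ := mem_support.1 (h₁.mem_support_of_ne hxy).1
      exact ⟨e, Finset.mem_union_left _ he⟩
    · rw [par_union hdisj, h₁.par_eq, h₂.par_eq, CharTwo.add_self_eq_zero]
  have hn : npar P₁ + npar P₂ = 1 := by
    rw [← npar_union hdisj, hunion, npar_eq_one]; exact hD.2
  have close : ∀ R P, SPath R x P z → P ⊆ D → npar P = npar Q →
      ∃ B ⊆ D ∪ D', G.IsBalancedCircuit B := by
    intro R P hP hPD hPQ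
    have hPQd : Disjoint P Q := hd.mono hPD hQ.subset
    refine ⟨P ∪ Q, Finset.union_subset_union hPD hQ.subset,
      isCircuit_union hP hQ hxy hPQd ?_, ?_⟩
    · intro w hw hwQ
      by_contra! hne
      exact (hinner w hwQ hne.1 hne.2).1 (support_mono hPD hw)
    · rw [← npar_eq_zero, npar_union hPQd, hPQ, CharTwo.add_self_eq_zero]
  rcases zmod_two_cases (npar P₁ + npar Q) with h | h
  · exact close _ P₁ h₁ h₁.subset (CharTwo.add_eq_zero.1 h)
  · refine close _ P₂ h₂ hsub₂ ?_
    rw [← hn] at h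
    exact (add_left_cancel h).symm

theorem exists_circuit_decomposition (Z : Finset G.E) (hZ : ∀ v, par Z v = 0) :
    ∃ 𝒞 : Finset (Finset G.E), (∀ C ∈ 𝒞, G.IsCircuit C) ∧
      (∀ C ∈ 𝒞, ∀ C' ∈ 𝒞, C ≠ C' → Disjoint C C') ∧ ∀ e, e ∈ Z ↔ ∃ C ∈ 𝒞, e ∈ C := by
  induction Z using Finset.strongInduction with
  | _ Z ih =>
    rcases Z.eq_empty_or_nonempty with rfl | ⟨e, he⟩
    · exact ⟨∅, by simp, by simp, by simp⟩
    obtain ⟨C, hCZ, heC, hC⟩ := exists_circuit_through hZ he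
    obtain ⟨𝒞, h1, h2, h3⟩ := ih (Z \ C) (Finset.sdiff_ssubset hCZ ⟨e, heC⟩)
      (fun v => by rw [par_sdiff hCZ, hZ, hC.par_eq, add_zero])
    have hdis : ∀ C' ∈ 𝒞, Disjoint C C' := fun C' hC' =>
      Finset.disjoint_left.2 fun f hf hf' =>
        (Finset.mem_sdiff.1 ((h3 f).2 ⟨C', hC', hf'⟩)).2 hf
    refine ⟨insert C 𝒞, ?_, ?_, fun f => ?_⟩
    · simpa [hC] using h1
    · intro A hA B hB hAB
      rcases Finset.mem_insert.1 hA with rfl | hA₂ <;>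
        rcases Finset.mem_insert.1 hB with rfl | hB₂
      · exact absurd rfl hAB
      · exact hdis B hB₂
      · exact (hdis A hA₂).symm
      · exact h2 A hA₂ B hB₂ hAB
    · have := h3 f
      rw [Finset.mem_sdiff] at this
      simp only [Finset.mem_insert, exists_eq_or_imp, ← this]
      by_cases hf : f ∈ C
      · simp [hf, hCZ hf]
      · simp [hf]

/-- `ℬ` and `ℛ` decompose `Z` into edge-disjoint circuits, balanced for `ℬ`, and unbalanced and
pairwise meeting in at most one vertex for `ℛ`. -/
structure Decomposes (ℬ ℛ : Finset (Finset G.E)) (Z : Finset G.E) : Prop where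
  balanced : ∀ B ∈ ℬ, G.IsBalancedCircuit B
  unbalanced : ∀ D ∈ ℛ, G.IsUnbalancedCircuit D
  disj_left : ∀ B ∈ ℬ, ∀ B' ∈ ℬ, B ≠ B' → Disjoint B B'
  disj : ∀ B ∈ ℬ, ∀ D ∈ ℛ, Disjoint B D
  disj_right : ∀ D ∈ ℛ, ∀ D' ∈ ℛ, D ≠ D' → Disjoint D D'
  meet : ∀ D ∈ ℛ, ∀ D' ∈ ℛ, D ≠ D' → (G.support D ∩ G.support D').card ≤ 1
  mem_iff : ∀ e, e ∈ Z ↔ (∃ B ∈ ℬ, e ∈ B) ∨ ∃ D ∈ ℛ, e ∈ D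

theorem exists_decomposes (Z : Finset G.E) (hZ : ∀ v, par Z v = 0) :
    ∃ ℬ ℛ, Decomposes (G := G) ℬ ℛ Z := by
  induction Z using Finset.strongInduction with
  | _ Z ih =>
    by_cases hB : ∃ B ⊆ Z, G.IsBalancedCircuit B
    · obtain ⟨B, hBZ, hB⟩ := hB
      obtain ⟨ℬ, ℛ, h⟩ := ih (Z \ B) (Finset.sdiff_ssubset hBZ hB.1.1)
        (fun v => by rw [par_sdiff hBZ, hZ, hB.1.par_eq, add_zero])
      have hdis : ∀ C, (C ∈ ℬ ∨ C ∈ ℛ) → Disjoint B C := fun C hC =>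
        Finset.disjoint_left.2 fun f hf hf' =>
          (Finset.mem_sdiff.1 ((h.mem_iff f).2
            (hC.imp (fun hC => ⟨C, hC, hf'⟩) (fun hC => ⟨C, hC, hf'⟩)))).2 hf
      refine ⟨insert B ℬ, ℛ, ?_, h.unbalanced, ?_, ?_, h.disj_right, h.meet, fun f => ?_⟩
      · simpa [hB] using h.balanced
      · intro A hA A' hA' hne
        rcases Finset.mem_insert.1 hA with rfl | hA₂ <;>
          rcases Finset.mem_insert.1 hA' with rfl | hA₃
        · exact absurd rfl hne
        · exact hdis _ (.inl hA₃)
        · exact (hdis _ (.inl hA₂)).symm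
        · exact h.disj_left A hA₂ A' hA₃ hne
      · intro A hA D hD
        rcases Finset.mem_insert.1 hA with rfl | hA
        · exact hdis _ (.inr hD)
        · exact h.disj A hA D hD
      · have := h.mem_iff f
        rw [Finset.mem_sdiff] at this
        simp only [Finset.mem_insert, exists_eq_or_imp, or_assoc, ← this]
        by_cases hf : f ∈ B
        · simp [hf, hBZ hf]
        · simp [hf]
    · obtain ⟨𝒞, h1, h2, h3⟩ := exists_circuit_decomposition Z hZ
      have hsub : ∀ C ∈ 𝒞, C ⊆ Z := fun C hC f hf => (h3 f).2 ⟨C, hC, hf⟩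
      have hun : ∀ C ∈ 𝒞, G.IsUnbalancedCircuit C := fun C hC =>
        ⟨h1 C hC, fun h => hB ⟨C, hsub C hC, h1 C hC, h⟩⟩
      refine ⟨∅, 𝒞, by simp, hun, by simp, by simp, h2, fun D hD D' hD' hne => ?_,
        fun f => by simp [h3]⟩
      by_contra! hc
      obtain ⟨B, hBs, hBb⟩ := exists_balanced (hun D hD) (hun D' hD') (h2 D hD D' hD' hne) hc
      exact hB ⟨B, hBs.trans (Finset.union_subset (hsub D hD) (hsub D' hD')), hBb⟩

theorem npar_biUnion (𝒞 : Finset (Finset G.E))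
    (h : ∀ C ∈ 𝒞, ∀ C' ∈ 𝒞, C ≠ C' → Disjoint C C') :
    npar (𝒞.biUnion id) = ∑ C ∈ 𝒞, npar C := by
  unfold npar negEdges
  rw [Finset.filter_biUnion, Finset.card_biUnion, Nat.cast_sum]
  · rfl
  · intro C hC C' hC' hne
    exact Finset.disjoint_filter_filter (h C hC C' hC' hne)

theorem Decomposes.npar_eq {ℬ ℛ : Finset (Finset G.E)} {Z : Finset G.E}
    (h : Decomposes ℬ ℛ Z) : npar Z = (ℛ.card : ZMod 2) := by
  have hZ : Z = ℬ.biUnion id ∪ ℛ.biUnion id := by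
    ext e; simp [h.mem_iff]
  have hd : Disjoint (ℬ.biUnion id) (ℛ.biUnion id) := by
    simp only [Finset.disjoint_biUnion_left, Finset.disjoint_biUnion_right]
    exact fun D hD B hB => h.disj B hB D hD
  rw [hZ, npar_union hd, npar_biUnion _ h.disj_left, npar_biUnion _ h.disj_right,
    Finset.sum_eq_zero fun B hB => npar_eq_zero.2 (h.balanced B hB).2,
    Finset.sum_congr rfl fun D hD => npar_eq_one.2 (h.unbalanced D hD).2]
  simp

/-! ### Joins in a connected spanning edge set -/

theorem exists_join_finset {T : Finset G.E} {x₀ : G.V} (hT : ∀ u v, G.Reach T u v)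
    (X : Finset G.V) : ∃ J ⊆ T, ∀ v, par J v =
      (if v ∈ X then 1 else 0) + (X.card : ZMod 2) * (if v = x₀ then 1 else 0) := by
  induction X using Finset.induction_on with
  | empty => exact ⟨∅, by simp, fun v => by simp [par, degIn_eq_sum_inc]⟩
  | insert a X ha ih =>
    obtain ⟨J, hJ, h⟩ := ih
    obtain ⟨P, hP⟩ := exists_sPath (hT a x₀)
    refine ⟨symmDiff J P, ?_, fun v => ?_⟩
    · exact (symmDiff_le_sup (a := J) (b := P)).trans (Finset.union_subset hJ hP.subset)
    · rw [par_symmDiff, h, hP.par_eq, Finset.card_insert_of_notMem ha, Nat.cast_succ]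
      have : (if v ∈ insert a X then (1 : ZMod 2) else 0) =
          (if v ∈ X then 1 else 0) + (if v = a then 1 else 0) := by
        by_cases hva : v = a
        · subst hva; simp [ha]
        · simp [hva]
      rw [this]; ring

theorem exists_join {T : Finset G.E} (hT : ∀ u v, G.Reach T u v) (g : G.V → ZMod 2)
    (hg : ∑ v, g v = 0) : ∃ J ⊆ T, ∀ v, par J v = g v := by
  have hgv : ∀ v, (if g v = 1 then (1 : ZMod 2) else 0) = g v := by
    intro v
    rcases zmod_two_cases (g v) with h | h <;> simp [h]
  rcases isEmpty_or_nonempty G.V with hV | ⟨⟨x₀⟩⟩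
  · exact ⟨∅, by simp, fun v => (hV.false v).elim⟩
  obtain ⟨J, hJ, h⟩ := exists_join_finset (x₀ := x₀) hT (Finset.univ.filter fun v => g v = 1)
  refine ⟨J, hJ, fun v => ?_⟩
  rw [h, Finset.card_filter, Nat.cast_sum]
  simp only [Finset.mem_filter, Finset.mem_univ, true_and, Nat.cast_ite, Nat.cast_one,
    Nat.cast_zero, hgv, hg, zero_mul, add_zero]

/-- Every edge set extends by edges of `T` to an even edge set. -/
theorem exists_even_extension {T : Finset G.E} (hT : ∀ u v, G.Reach T u v) {X : Finset G.E}
    (hX : Disjoint X T) : ∃ J ⊆ T, ∀ v, par (X ∪ J) v = 0 := by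
  obtain ⟨J, hJ, h⟩ := exists_join hT (par X) (by
    rw [sum_par]
    have : G.boundary X Finset.univ = ∅ := by
      ext e
      obtain ⟨a, b, hab⟩ := exists_ends e
      simp [mem_boundary, crossesB_eq hab]
    simp [this])
  refine ⟨J, hJ, fun v => ?_⟩
  rw [par_union (hX.mono_right hJ), h, CharTwo.add_self_eq_zero]

/-! ### Barbells -/

theorem exists_barbell {D D' Q : Finset G.E} (hD : G.IsUnbalancedCircuit D)
    (hD' : G.IsUnbalancedCircuit D') (hd : Disjoint D D')
    (hm : (G.support D ∩ G.support D').card ≤ 1) {c c' : G.V} (hc : c ∈ G.support D)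
    (hc' : c' ∈ G.support D') (hQ : G.Reach Q c c') :
    ∃ S, G.IsSignedCircuit S ∧ G.ConnOn S ∧ D ⊆ S ∧ D' ⊆ S ∧
      ∀ e ∈ S, e ∈ D ∨ e ∈ D' ∨ (e ∈ Q ∧ ¬ (G.ends e).IsDiag ∧
        ∀ U b, G.boundary Finset.univ U = {b} → Disjoint (G.support D) U →
          Disjoint (G.support D') U → ∃ v ∈ G.ends e, v ∉ U) := by
  by_cases hs : (G.support D ∩ G.support D').card = 1
  · obtain ⟨x, hx⟩ := Finset.card_eq_one.1 hs
    have hx' : x ∈ G.support D ∩ G.support D' := by simp [hx]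
    rw [Finset.mem_inter] at hx'
    exact ⟨D ∪ D', .inr (.inl ⟨D, D', hD, hD', hd, hs, rfl⟩),
      connOn_union hD.1.2.1 hD'.1.2.1 hx'.1 hx'.2, Finset.subset_union_left,
      Finset.subset_union_right, fun e he => by
        rcases Finset.mem_union.1 he with h | h
        exacts [.inl h, .inr (.inl h)]⟩
  have hds : Disjoint (G.support D) (G.support D') := by
    rw [Finset.disjoint_iff_inter_eq_empty, ← Finset.card_eq_zero]; omega
  obtain ⟨x, P, y, hP, hxy, hx, hy, hinner⟩ :=
    exists_link (Q := Q) (· ∈ G.support D) (· ∈ G.support D')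
      ⟨c, c', fun h => Finset.disjoint_left.1 hds hc (h ▸ hc'), hc, hc', hQ⟩
  obtain ⟨hxP, hyP⟩ := hP.mem_support_of_ne hxy
  have hPD : G.support P ∩ G.support D = {x} := by
    ext w
    rw [Finset.mem_inter, Finset.mem_singleton]
    refine ⟨fun ⟨hw, hwD⟩ => ?_, by rintro rfl; exact ⟨hxP, hx⟩⟩
    by_contra hwx
    by_cases hwy : w = y
    · subst hwy; exact Finset.disjoint_left.1 hds hwD hy
    · exact (hinner w hw hwx hwy).1 hwD
  have hPD' : G.support P ∩ G.support D' = {y} := by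
    ext w
    rw [Finset.mem_inter, Finset.mem_singleton]
    refine ⟨fun ⟨hw, hwD⟩ => ?_, by rintro rfl; exact ⟨hyP, hy⟩⟩
    by_contra hwy
    by_cases hwx : w = x
    · subst hwx; exact Finset.disjoint_left.1 hds hx hwD
    · exact (hinner w hw hwx hwy).2 hwD
  have hdisj : ∀ C z, G.support P ∩ G.support C = {z} → Disjoint P C := by
    intro C z hz
    refine Finset.disjoint_left.2 fun e he heC => hP.not_isDiag e he ?_
    obtain ⟨a, b, hab⟩ := exists_ends e
    have h1 : ∀ w ∈ G.ends e, w = z := fun w hw => by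
      rw [← Finset.mem_singleton, ← hz, Finset.mem_inter]
      exact ⟨mem_support.2 ⟨e, he, hw⟩, mem_support.2 ⟨e, heC, hw⟩⟩
    rw [hab, Sym2.mk_isDiag_iff, h1 a (by simp [hab]), h1 b (by simp [hab])]
  refine ⟨D ∪ D' ∪ P, .inr (.inr ⟨D, D', P, x, y, hD, hD', hds, hP.isPath hxy, hPD, hPD',
    hdisj _ _ hPD, hdisj _ _ hPD', rfl⟩), ?_, ?_, ?_, ?_⟩
  · have h1 := connOn_union hD.1.2.1 hP.connOn hx hxP
    have h2 := connOn_union h1 hD'.1.2.1 (by rw [support_union, Finset.mem_union]; exact .inr hyP) hy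
    rwa [Finset.union_right_comm] at h2
  · exact Finset.subset_union_left.trans Finset.subset_union_left
  · exact Finset.subset_union_right.trans Finset.subset_union_left
  · intro e he
    rcases Finset.mem_union.1 he with he | he
    · rcases Finset.mem_union.1 he with h | h
      exacts [.inl h, .inr (.inl h)]
    · refine .inr (.inr ⟨hP.subset he, hP.not_isDiag e he, fun U b hU h1 h2 => ?_⟩)
      have h3 := hP.disjoint_side hU (Finset.disjoint_left.1 h1 hx) (Finset.disjoint_left.1 h2 hy)
      obtain ⟨a, a', ha⟩ := exists_ends e
      have ha' : a ∈ G.ends e := by simp [ha]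
      exact ⟨a, ha', Finset.disjoint_left.1 h3 (mem_support.2 ⟨e, he, ha'⟩)⟩


/-! ### Counting -/

/-- Indicator of an edge set. -/
def ind (S : Finset G.E) (e : G.E) : ℕ := if e ∈ S then 1 else 0

theorem ind_le_one (S : Finset G.E) (e : G.E) : ind S e ≤ 1 := by
  unfold ind; split_ifs <;> omega

theorem ind_of_mem {S : Finset G.E} {e : G.E} (h : e ∈ S) : ind S e = 1 := if_pos h

theorem ind_of_notMem {S : Finset G.E} {e : G.E} (h : e ∉ S) : ind S e = 0 := if_neg h

theorem ind_mono {S S' : Finset G.E} (h : S ⊆ S') (e : G.E) : ind S e ≤ ind S' e := by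
  by_cases he : e ∈ S
  · rw [ind_of_mem he, ind_of_mem (h he)]
  · rw [ind_of_notMem he]; exact Nat.zero_le _

theorem ind_union {S S' : Finset G.E} (h : Disjoint S S') (e : G.E) :
    ind (S ∪ S') e = ind S e + ind S' e := by
  have := @Finset.disjoint_left _ S S'
  unfold ind
  by_cases h1 : e ∈ S
  · simp [h1, this.1 h h1]
  · simp [h1]

theorem sum_ind {𝒞 : Finset (Finset G.E)} (h : ∀ C ∈ 𝒞, ∀ C' ∈ 𝒞, C ≠ C' → Disjoint C C')
    (e : G.E) : ∑ C ∈ 𝒞, ind C e = ind (𝒞.biUnion id) e := by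
  by_cases he : ∃ C ∈ 𝒞, e ∈ C
  · obtain ⟨C, hC, heC⟩ := he
    rw [ind_of_mem (Finset.mem_biUnion.2 ⟨C, hC, heC⟩), Finset.sum_eq_single_of_mem C hC,
      ind_of_mem heC]
    exact fun C' hC' hne => ind_of_notMem fun h' =>
      Finset.disjoint_left.1 (h C' hC' C hC hne) h' heC
  · push Not at he
    rw [ind_of_notMem (by simpa using he), Finset.sum_eq_zero]
    exact fun C hC => ind_of_notMem (he C hC)

theorem Decomposes.sum_ind_add {ℬ ℛ : Finset (Finset G.E)} {Z : Finset G.E}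
    (h : Decomposes ℬ ℛ Z) (e : G.E) :
    ∑ B ∈ ℬ, ind B e + ∑ D ∈ ℛ, ind D e = ind Z e := by
  have hZ : Z = ℬ.biUnion id ∪ ℛ.biUnion id := by
    ext e; simp [h.mem_iff]
  have hd : Disjoint (ℬ.biUnion id) (ℛ.biUnion id) := by
    simp only [Finset.disjoint_biUnion_left, Finset.disjoint_biUnion_right]
    exact fun D hD B hB => h.disj B hB D hD
  rw [sum_ind h.disj_left, sum_ind h.disj_right, hZ, ind_union hd]

theorem coverCount_eq (F : Multiset (Finset G.E)) (e : G.E) :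
    G.coverCount F e = (F.map (ind · e)).sum := by
  unfold coverCount
  induction F using Multiset.induction_on with
  | empty => simp
  | cons S F ih =>
    rw [Multiset.map_cons, Multiset.sum_cons, ← ih, Multiset.filter_cons, Multiset.card_add]
    by_cases h : e ∈ S <;> simp [h, ind]

theorem coverCount_zero (e : G.E) : G.coverCount 0 e = 0 := by simp [coverCount]

theorem coverCount_cons (S : Finset G.E) (F : Multiset (Finset G.E)) (e : G.E) :
    G.coverCount (S ::ₘ F) e = ind S e + G.coverCount F e := by
  simp [coverCount_eq]

theorem coverCount_add (F F' : Multiset (Finset G.E)) (e : G.E) :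
    G.coverCount (F + F') e = G.coverCount F e + G.coverCount F' e := by
  simp [coverCount_eq]

theorem coverCount_val (ℬ : Finset (Finset G.E)) (e : G.E) :
    G.coverCount ℬ.val e = ∑ B ∈ ℬ, ind B e := by
  rw [coverCount_eq]; rfl

theorem one_le_coverCount {F : Multiset (Finset G.E)} {S : Finset G.E} {e : G.E} (hS : S ∈ F)
    (he : e ∈ S) : 1 ≤ G.coverCount F e := by
  rw [coverCount, Nat.one_le_iff_ne_zero, ← Nat.pos_iff_ne_zero, Multiset.card_pos_iff_exists_mem]
  exact ⟨S, Multiset.mem_filter.2 ⟨hS, he⟩⟩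

/-! ### Linking unbalanced circuits along a join -/

theorem exists_linking (ℛ : Finset (Finset G.E)) (hu : ∀ D ∈ ℛ, G.IsUnbalancedCircuit D)
    (hd : ∀ D ∈ ℛ, ∀ D' ∈ ℛ, D ≠ D' → Disjoint D D')
    (hm : ∀ D ∈ ℛ, ∀ D' ∈ ℛ, D ≠ D' → (G.support D ∩ G.support D').card ≤ 1)
    (p : Finset G.E → G.V) (hp : ∀ D ∈ ℛ, p D ∈ G.support D) (J : Finset G.E)
    (hJ : ∀ v, par J v = ∑ D ∈ ℛ, if v = p D then 1 else 0) :
    ∃ F : Multiset (Finset G.E), (∀ S ∈ F, G.IsSignedCircuit S) ∧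
      (∀ e, G.coverCount F e ≤ ∑ D ∈ ℛ, ind D e + ind J e) ∧ ∀ D ∈ ℛ, ∃ S ∈ F, D ⊆ S := by
  induction ℛ using Finset.strongInduction generalizing J with
  | _ ℛ ih =>
    rcases ℛ.eq_empty_or_nonempty with rfl | ⟨D, hD⟩
    · exact ⟨0, by simp, by simp [coverCount_zero], by simp⟩
    obtain ⟨D', hD', hne, P, hP, hPpar, hr⟩ : ∃ D' ∈ ℛ, D' ≠ D ∧ ∃ P ⊆ J,
        (∀ v, par P v = (if v = p D then 1 else 0) + (if v = p D' then 1 else 0)) ∧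
        G.Reach P (p D) (p D') := by
      by_cases h : ∃ D' ∈ ℛ, D' ≠ D ∧ p D' = p D
      · obtain ⟨D', hD', hne, h⟩ := h
        refine ⟨D', hD', hne, ∅, by simp, fun v => ?_, h ▸ Relation.ReflTransGen.refl⟩
        rw [h, CharTwo.add_self_eq_zero]
        simp [par, degIn_eq_sum_inc]
      · push Not at h
        obtain ⟨y, hy, hr, hy1⟩ := reach_of_par (J := J) (x := p D) (by
          rw [hJ, Finset.sum_eq_single_of_mem D hD (fun D' hD' hne => if_neg (h D' hD' hne).symm)]
          simp)
        rw [hJ] at hy1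
        obtain ⟨D', hD', hy'⟩ := Finset.exists_ne_zero_of_sum_ne_zero (hy1 ▸ one_ne_zero)
        have hyD : y = p D' := by by_contra hc; simp [hc] at hy'
        subst hyD
        obtain ⟨P, hP⟩ := exists_sPath hr
        refine ⟨D', hD', fun hc => hy (hc ▸ rfl), P, hP.subset, hP.par_eq, ?_⟩
        exact hP.reach _ (hP.mem_support_of_ne hy.symm).2
    obtain ⟨S, hS, -, hDS, hD'S, hSe⟩ := exists_barbell (hu D hD) (hu D' hD')
      (hd D hD D' hD' hne.symm) (hm D hD D' hD' hne.symm) (hp D hD) (hp D' hD') hr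
    have hD'e : D' ∈ ℛ.erase D := Finset.mem_erase.2 ⟨hne, hD'⟩
    have hsub : (ℛ.erase D).erase D' ⊆ ℛ :=
      (Finset.erase_subset _ _).trans (Finset.erase_subset _ _)
    obtain ⟨F, hF, hc, hF'⟩ := ih ((ℛ.erase D).erase D')
      ((Finset.erase_subset _ _).trans_ssubset (Finset.erase_ssubset hD))
      (fun A hA => hu A (hsub hA)) (fun A hA B hB => hd A (hsub hA) B (hsub hB))
      (fun A hA B hB => hm A (hsub hA) B (hsub hB)) (fun A hA => hp A (hsub hA)) (J \ P)
      (fun v => by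
        rw [par_sdiff hP, hJ, ← Finset.add_sum_erase _ _ hD, ← Finset.add_sum_erase _ _ hD'e,
          hPpar]
        generalize (∑ D ∈ (ℛ.erase D).erase D', if v = p D then (1 : ZMod 2) else 0) = s
        generalize (if v = p D then (1 : ZMod 2) else 0) = a
        generalize (if v = p D' then (1 : ZMod 2) else 0) = b
        revert s a b; decide)
    refine ⟨S ::ₘ F, ?_, fun e => ?_, fun A hA => ?_⟩
    · simpa [hS] using hF
    · have h1 := hc e
      have h2 : ind J e = ind P e + ind (J \ P) e := by
        rw [← ind_union Finset.disjoint_sdiff, Finset.union_sdiff_of_subset hP]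
      have h3 : ind S e ≤ ind D e + ind D' e + ind P e := by
        by_cases he : e ∈ S
        · rw [ind_of_mem he]
          rcases hSe e he with h | h | h
          · rw [ind_of_mem h]; omega
          · rw [ind_of_mem h]; omega
          · rw [ind_of_mem h.1]; omega
        · rw [ind_of_notMem he]; omega
      rw [coverCount_cons, ← Finset.add_sum_erase _ _ hD, ← Finset.add_sum_erase _ _ hD'e]
      omega
    · by_cases hAD : A = D
      · exact ⟨S, by simp, hAD ▸ hDS⟩
      by_cases hAD' : A = D'
      · exact ⟨S, by simp, hAD' ▸ hD'S⟩
      · obtain ⟨S', hS', h⟩ := hF' A (by simp [hA, hAD, hAD'])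
        exact ⟨S', by simp [hS'], h⟩

theorem IsCircuit.support_nonempty {C : Finset G.E} (hC : G.IsCircuit C) :
    (G.support C).Nonempty := by
  obtain ⟨e, he⟩ := hC.1
  obtain ⟨a, b, hab⟩ := exists_ends e
  exact ⟨a, mem_support.2 ⟨e, he, by simp [hab]⟩⟩

theorem exists_base [Nonempty G.V] (ℛ : Finset (Finset G.E))
    (hu : ∀ D ∈ ℛ, G.IsUnbalancedCircuit D) :
    ∃ p : Finset G.E → G.V, ∀ D ∈ ℛ, p D ∈ G.support D := by
  refine ⟨fun D => if h : (G.support D).Nonempty then h.choose else Classical.arbitrary _,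
    fun D hD => ?_⟩
  have h := (hu D hD).1.support_nonempty
  simp only [h, dif_pos]
  exact h.choose_spec

theorem npar_even_extension {T X J : Finset G.E} (hT : ∀ e ∈ T, G.neg e = false)
    (hX : ∀ e ∈ X, G.neg e = true) (hJ : J ⊆ T) : npar (X ∪ J) = (X.card : ZMod 2) := by
  have : G.negEdges (X ∪ J) = X := by
    ext e
    simp only [negEdges, Finset.mem_filter, Finset.mem_union]
    constructor
    · rintro ⟨h | h, h'⟩
      · exact h
      · simp [hT e (hJ h)] at h'
    · exact fun h => ⟨.inl h, hX e h⟩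
  rw [npar, this]

/-- An even set of negative edges has a cover with multiplicity at most two. -/
theorem exists_cover_of_even [Nonempty G.V] {T X : Finset G.E} (hT : ∀ u v, G.Reach T u v)
    (hTn : ∀ e ∈ T, G.neg e = false) (hX : ∀ e ∈ X, G.neg e = true) (hev : Even X.card) :
    ∃ F : Multiset (Finset G.E), (∀ S ∈ F, G.IsSignedCircuit S) ∧
      (∀ e, G.coverCount F e ≤ ind X e + 2 * ind T e) ∧
      ∀ e ∈ X, ∃ S ∈ F, ∃ C ⊆ S, G.IsCircuit C ∧ e ∈ C := by
  have hXT : Disjoint X T := Finset.disjoint_left.2 fun e he he' => by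
    simpa [hX e he] using hTn e he'
  obtain ⟨J, hJ, hpar⟩ := exists_even_extension hT hXT
  obtain ⟨ℬ, ℛ, h⟩ := exists_decomposes _ hpar
  obtain ⟨p, hp⟩ := exists_base ℛ h.unbalanced
  obtain ⟨J', hJ', hpar'⟩ := exists_join hT (fun v => ∑ D ∈ ℛ, if v = p D then 1 else 0) (by
    rw [Finset.sum_comm]
    simp only [Finset.sum_ite_eq', Finset.mem_univ, if_true, Finset.sum_const, nsmul_eq_mul,
      mul_one]
    rw [← h.npar_eq, npar_even_extension hTn hX hJ]
    exact ZMod.natCast_eq_zero_iff_even.2 hev)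
  obtain ⟨F, hF, hc, hF'⟩ := exists_linking ℛ h.unbalanced h.disj_right h.meet p hp J' hpar'
  refine ⟨ℬ.val + F, fun S hS => ?_, fun e => ?_, fun e he => ?_⟩
  · rcases Multiset.mem_add.1 hS with hS | hS
    · exact .inl (h.balanced S hS)
    · exact hF S hS
  · have h1 := hc e
    have h2 := h.sum_ind_add e
    rw [ind_union (hXT.mono_right hJ)] at h2
    have h3 := ind_mono hJ e
    have h4 := ind_mono hJ' e
    rw [coverCount_add, coverCount_val]
    omega
  · rcases (h.mem_iff e).1 (Finset.mem_union_left _ he) with ⟨B, hB, heB⟩ | ⟨D, hD, heD⟩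
    · exact ⟨B, Multiset.mem_add.2 (.inl hB), B, subset_rfl, (h.balanced B hB).1, heB⟩
    · obtain ⟨S, hS, hDS⟩ := hF' D hD
      exact ⟨S, Multiset.mem_add.2 (.inr hS), D, hDS, (h.unbalanced D hD).1, heD⟩

theorem exists_signed_through [Nonempty G.V] {T : Finset G.E} (hT : ∀ u v, G.Reach T u v)
    (hTn : ∀ e ∈ T, G.neg e = false) {e₁ e₂ : G.E} (h₁ : G.neg e₁ = true)
    (h₂ : G.neg e₂ = true) (hne : e₁ ≠ e₂) :
    ∃ S, G.IsSignedCircuit S ∧ S ⊆ insert e₁ (insert e₂ T) ∧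
      ∃ C ⊆ S, G.IsCircuit C ∧ e₁ ∈ C := by
  have hX : ∀ e ∈ ({e₁, e₂} : Finset G.E), G.neg e = true := by simp [h₁, h₂]
  obtain ⟨F, hF, hc, hF'⟩ := exists_cover_of_even hT hTn hX (by
    rw [Finset.card_pair hne]; decide)
  obtain ⟨S, hS, hC⟩ := hF' e₁ (by simp)
  refine ⟨S, hF S hS, fun e he => ?_, hC⟩
  by_contra hn
  have h1 := one_le_coverCount hS he
  have h2 := hc e
  rw [Finset.mem_insert, Finset.mem_insert, not_or, not_or] at hn
  rw [ind_of_notMem (by simp [hn.1, hn.2.1]), ind_of_notMem hn.2.2] at h2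
  omega

/-! ### Walks -/

/-- `Walk u m A v`: there is a walk from `u` to `v` that uses the multiset `m` of edges and visits
exactly the vertices of `A`. -/
inductive Walk : G.V → Multiset G.E → Finset G.V → G.V → Prop
  | nil (u : G.V) : Walk u 0 {u} u
  | cons {e : G.E} {u w v : G.V} {m : Multiset G.E} {A : Finset G.V}
      (he : G.ends e = s(u, w)) (h : Walk w m A v) : Walk u (e ::ₘ m) (insert u A) v

namespace Walk

variable {u v w x : G.V} {m m' : Multiset G.E} {A A' : Finset G.V}

theorem start_mem (h : Walk u m A v) : u ∈ A := by
  cases h <;> simp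

theorem append (h : Walk u m A v) (h' : Walk v m' A' w) : Walk u (m + m') (A ∪ A') w := by
  induction h with
  | nil u =>
    have hu := h'.start_mem
    have : {u} ∪ A' = A' := by ext; simp; rintro rfl; exact hu
    rwa [zero_add, this]
  | cons he _ ih =>
    rw [Multiset.cons_add, Finset.insert_union]
    exact .cons he (ih h')

theorem splice (h : Walk u m A v) (hx : x ∈ A) (h' : Walk x m' A' x) :
    Walk u (m + m') (A ∪ A') v := by
  induction h with
  | nil u =>
    rw [Finset.mem_singleton] at hx
    subst hx
    exact (Walk.nil x).append h'
  | @cons e u w v m A he hw ih =>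
    by_cases hxu : x = u
    · subst hxu
      rw [add_comm, Finset.union_comm]
      exact h'.append (.cons he hw)
    · rw [Multiset.cons_add, Finset.insert_union]
      exact .cons he (ih ((Finset.mem_insert.1 hx).resolve_left hxu))

theorem ends_mem (h : Walk u m A v) {e : G.E} (he : e ∈ m) : ∀ x ∈ G.ends e, x ∈ A := by
  induction h with
  | nil u => simp at he
  | @cons f u w v m A hf hw ih =>
    intro x hx
    rcases Multiset.mem_cons.1 he with rfl | he
    · rw [hf, Sym2.mem_iff] at hx
      rcases hx with rfl | rfl
      · simp
      · exact Finset.mem_insert_of_mem hw.start_mem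
    · exact Finset.mem_insert_of_mem (ih he x hx)

end Walk

theorem SPath.walk {Q P : Finset G.E} {x z : G.V} (h : SPath Q x P z) :
    ∃ A, Walk x P.val A z ∧ G.support P ⊆ A := by
  induction h with
  | nil x => exact ⟨{x}, .nil x, by simp [support_empty]⟩
  | @cons e x y z P he hs hP hx hxz ih =>
    obtain ⟨A, hA, hPA⟩ := ih
    have heP : e ∉ P := fun h => hx (mem_support.2 ⟨e, h, by simp [hs]⟩)
    refine ⟨insert x A, ?_, ?_⟩
    · rw [Finset.insert_val_of_notMem heP]
      exact .cons hs hA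
    · rw [support_insert hs]
      exact Finset.insert_subset_insert _ (Finset.insert_subset hA.start_mem hPA)

theorem IsCircuit.walk {C : Finset G.E} (hC : G.IsCircuit C) {x : G.V} (hx : x ∈ G.support C) :
    ∃ m A, Walk x m A x ∧ (∀ e, m.count e ≤ ind C e) ∧ G.support C ⊆ A := by
  obtain ⟨e, he, hxe⟩ := mem_support.1 hx
  obtain ⟨y, hy⟩ := Sym2.mem_iff_exists.1 hxe
  by_cases hxy : x = y
  · subst hxy
    have := hC.eq_loop he (by simp [hy])
    subst this
    refine ⟨{e}, {x}, ?_, fun f => ?_, fun v hv => ?_⟩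
    · simpa using Walk.cons hy (.nil x)
    · unfold ind
      by_cases h : f = e <;> simp [h]
    · obtain ⟨f, hf, hvf⟩ := mem_support.1 hv
      rw [Finset.mem_singleton] at hf
      subst hf
      simpa [hy] using hvf
  · obtain ⟨P, hP⟩ := exists_sPath_erase hC.par_eq he hy hxy
    have heP : e ∉ P := fun h => by simpa using hP.subset h
    have hs : SPath {e} x {e} y := sPath_single hy hxy
    have hins : insert e P = C := by
      refine hC.eq_of_subset (Finset.insert_subset he (hP.subset.trans (Finset.erase_subset _ _)))
        ⟨e, by simp⟩ fun v => ?_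
      rw [Finset.insert_eq, par_union (Finset.disjoint_singleton_left.2 heP), hs.par_eq, hP.par_eq,
        add_comm (if v = y then (1 : ZMod 2) else 0), CharTwo.add_self_eq_zero]
    obtain ⟨A, hA, hPA⟩ := hP.walk
    refine ⟨e ::ₘ P.val, insert x A, .cons hy hA, fun f => ?_, ?_⟩
    · rw [← Finset.insert_val_of_notMem heP, hins]
      exact (Multiset.count_eq_of_nodup C.nodup).le
    · rw [← hins, support_insert hy]
      exact Finset.insert_subset_insert _ (Finset.insert_subset hA.start_mem hPA)

theorem exists_tour {T : Finset G.E} (hT : ∀ u v, G.Reach T u v) {ℛ : Finset (Finset G.E)}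
    (hu : ∀ D ∈ ℛ, G.IsCircuit D) (hd : ∀ D ∈ ℛ, ∀ D' ∈ ℛ, D ≠ D' → Disjoint D D') (x₀ : G.V) :
    ∃ m, Walk x₀ m Finset.univ x₀ ∧
      ∀ e, m.count e ≤ if ∃ D ∈ ℛ, e ∈ D then 1 else 2 * ind T e := by
  have key : ∀ n, ∃ m A, Walk x₀ m A x₀ ∧
      (∀ e, m.count e ≤ if ∃ D ∈ ℛ, e ∈ D then 1 else 2 * ind T e) ∧
      (∀ D ∈ ℛ, G.support D ⊆ A ∨ ∀ e ∈ D, e ∉ m) ∧ (A = Finset.univ ∨ n ≤ A.card) := by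
    intro n
    induction n with
    | zero => exact ⟨0, {x₀}, .nil x₀, by simp, by simp, by simp⟩
    | succ n ih =>
      obtain ⟨m, A, hw, hm, hR, hA⟩ := ih
      by_cases hAu : A = Finset.univ
      · exact ⟨m, A, hw, hm, hR, .inl hAu⟩
      have hn := hA.resolve_left hAu
      obtain ⟨z, hz⟩ : ∃ z, z ∉ A := by
        by_contra! hc
        exact hAu (Finset.eq_univ_iff_forall.2 hc)
      obtain ⟨f, hfT, x, y, hf, hx, hy⟩ := reach_cross (hT x₀ z) hw.start_mem hz
      have hfm : f ∉ m := fun h => hy (hw.ends_mem h y (by simp [hf]))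
      have hcard : ∀ A', y ∈ A' → n + 1 ≤ (A ∪ A').card := fun A' hA' =>
        hn.trans_lt (Finset.card_lt_card (Finset.ssubset_iff_subset_ne.2
          ⟨Finset.subset_union_left, fun h => hy (h ▸ Finset.mem_union_right _ hA')⟩))
      by_cases hfR : ∃ D ∈ ℛ, f ∈ D
      · obtain ⟨D, hD, hfD⟩ := hfR
        have hyD : y ∈ G.support D := mem_support.2 ⟨f, hfD, by simp [hf]⟩
        have hD0 := (hR D hD).resolve_left fun h => hy (h hyD)
        obtain ⟨m', A', hw', hm', hA'⟩ :=
          (hu D hD).walk (mem_support.2 ⟨f, hfD, by simp [hf]⟩ : x ∈ G.support D)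
        have hm0 : ∀ e, e ∉ D → m'.count e = 0 := fun e he => by
          have := hm' e
          rw [ind_of_notMem he] at this
          omega
        refine ⟨m + m', A ∪ A', hw.splice hx hw', fun e => ?_, fun D' hD' => ?_,
          .inr (hcard A' (hA' hyD))⟩
        · rw [Multiset.count_add]
          by_cases he : e ∈ D
          · rw [if_pos ⟨D, hD, he⟩, Multiset.count_eq_zero_of_notMem (hD0 e he), zero_add]
            exact (hm' e).trans (ind_le_one _ _)
          · rw [hm0 e he, add_zero]
            exact hm e
        · by_cases h : D' = D
          · subst h
            exact .inl (hA'.trans Finset.subset_union_right)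
          · refine (hR D' hD').imp (fun h => h.trans Finset.subset_union_left) fun h' e he => ?_
            rw [Multiset.mem_add, not_or]
            exact ⟨h' e he, Multiset.count_eq_zero.1
              (hm0 e (Finset.disjoint_left.1 (hd D' hD' D hD h) he))⟩
      · have hw' : Walk x (f ::ₘ f ::ₘ 0) (insert x (insert y {x})) x :=
          .cons hf (.cons (hf.trans Sym2.eq_swap) (.nil x))
        refine ⟨_, _, hw.splice hx hw', fun e => ?_, fun D' hD' => ?_, .inr (hcard _ (by simp))⟩
        · rw [Multiset.count_add]
          by_cases he : e = f
          · subst he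
            rw [if_neg hfR, ind_of_mem hfT, Multiset.count_eq_zero_of_notMem hfm]
            simp
          · simpa [Multiset.count_cons, he] using hm e
        · refine (hR D' hD').imp (fun h => h.trans Finset.subset_union_left) fun h' e he => ?_
          have hef : e ≠ f := fun h => hfR ⟨D', hD', h ▸ he⟩
          simp [h' e he, hef]
  obtain ⟨m, A, hw, hm, -, hA⟩ := key (Fintype.card G.V + 1)
  rcases hA with rfl | hA
  · exact ⟨m, hw, hm⟩
  · have := A.card_le_univ
    omega

/-! ### Chains of barbells along a walk -/

theorem exists_chain {good : G.E → Prop} {𝓣 : Finset (Finset G.E)}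
    (hne : ∀ D ∈ 𝓣, (G.support D).Nonempty)
    (hd : ∀ D ∈ 𝓣, ∀ D' ∈ 𝓣, D ≠ D' → Disjoint D D')
    (hb : ∀ D ∈ 𝓣, ∀ D' ∈ 𝓣, D ≠ D' → ∀ (Q : Finset G.E) (c c' : G.V), c ∈ G.support D →
      c' ∈ G.support D' → G.Reach Q c c' → ∃ S, G.IsSignedCircuit S ∧ G.ConnOn S ∧ D ⊆ S ∧
        D' ⊆ S ∧ ∀ e ∈ S, e ∈ D ∨ e ∈ D' ∨ (e ∈ Q ∧ good e))
    {D₀ : Finset G.E} (hD₀ : D₀ ∈ 𝓣) {v : G.V} (hv : v ∈ G.support D₀) (n : ℕ) :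
    ∀ (u : G.V) (m : Multiset G.E) (A : Finset G.V), Walk u m A v →
    ∀ D ∈ 𝓣, ∀ (pend : Multiset G.E) (c : G.V), ∀ 𝓤 ⊆ 𝓣, D ∉ 𝓤 → D₀ ∉ 𝓤 → c ∈ G.support D →
      G.Reach pend.toFinset c u → (D ≠ D₀ ∨ 𝓤.Nonempty) →
      (∀ D' ∈ 𝓤, ∃ w ∈ A, w ∈ G.support D') → m.card + 𝓤.card < n →
    ∃ F : Multiset (Finset G.E), (∀ S ∈ F, G.IsSignedCircuit S) ∧
      (∀ e, ind D e + ind D₀ e + 2 * ∑ D' ∈ 𝓤, ind D' e ≤ G.coverCount F e) ∧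
      (∀ e, G.coverCount F e ≤ ind D e + ind D₀ e + 2 * ∑ D' ∈ 𝓤, ind D' e +
        if good e then pend.count e + m.count e else 0) ∧
      ∀ U, G.support D ⊆ U → (∃ D' ∈ insert D₀ 𝓤, Disjoint (G.support D') U) →
        ∃ e ∈ G.boundary Finset.univ U, 1 ≤ G.coverCount F e := by
  have link : ∀ D ∈ 𝓣, ∀ D' ∈ 𝓣, D ≠ D' → ∀ (pend : Multiset G.E) (c c' : G.V),
      c ∈ G.support D → c' ∈ G.support D' → G.Reach pend.toFinset c c' →
      ∃ S, G.IsSignedCircuit S ∧ (∀ e, ind D e + ind D' e ≤ ind S e) ∧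
        (∀ e, ind S e ≤ ind D e + ind D' e + if good e then pend.count e else 0) ∧
        ∀ U, G.support D ⊆ U → ¬ G.support D' ⊆ U → ∃ e ∈ S, e ∈ G.boundary Finset.univ U := by
    intro D hD D' hD' hDD' pend c c' hc hc' hr
    obtain ⟨S, hS, hconn, hDS, hD'S, hSe⟩ := hb D hD D' hD' hDD' _ c c' hc hc' hr
    refine ⟨S, hS, fun e => ?_, fun e => ?_, fun U hU hU' => ?_⟩
    · rw [← ind_union (hd D hD D' hD' hDD')]
      exact ind_mono (Finset.union_subset hDS hD'S) e
    · by_cases he : e ∈ S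
      · rw [ind_of_mem he]
        rcases hSe e he with h | h | ⟨h, hg⟩
        · rw [ind_of_mem h]; omega
        · rw [ind_of_mem h]; omega
        · rw [if_pos hg]
          have := Multiset.one_le_count_iff_mem.2 (Multiset.mem_toFinset.1 h)
          omega
      · rw [ind_of_notMem he]; omega
    · obtain ⟨z, hz, hzU⟩ := Finset.not_subset.1 hU'
      obtain ⟨e, he, hce⟩ := connOn_cross hconn (U := U) (support_mono hDS hc)
        (support_mono hD'S hz) (by simp [hU hc, hzU])
      exact ⟨e, he, mem_boundary.2 ⟨Finset.mem_univ e, hce⟩⟩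
  have not_sub : ∀ D ∈ 𝓣, ∀ U, Disjoint (G.support D) U → ¬ G.support D ⊆ U := by
    intro D hD U h1 h2
    obtain ⟨z, hz⟩ := hne D hD
    exact Finset.disjoint_left.1 h1 hz (h2 hz)
  induction n with
  | zero => intros; omega
  | succ n ih =>
    intro u m A hw D hD pend c 𝓤 h𝓤 hD𝓤 hD₀𝓤 hc hr hor hmeet hcard
    by_cases hu : ∃ D' ∈ 𝓤, u ∈ G.support D'
    · obtain ⟨D', hD', huD'⟩ := hu
      have hDD' : D ≠ D' := fun h => hD𝓤 (h ▸ hD')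
      obtain ⟨S, hS, hle, hge, hcross⟩ := link D hD D' (h𝓤 hD') hDD' pend c u hc huD' hr
      have hcard' := Finset.card_erase_add_one hD'
      obtain ⟨F, hF, hlo, hhi, hcov⟩ := ih u m A hw D' (h𝓤 hD') 0 u (𝓤.erase D')
        ((Finset.erase_subset _ _).trans h𝓤) (Finset.notMem_erase _ _)
        (fun h => hD₀𝓤 (Finset.mem_of_mem_erase h)) huD' .refl
        (.inl fun h => hD₀𝓤 (h ▸ hD')) (fun D'' h => hmeet D'' (Finset.mem_of_mem_erase h))
        (by omega)
      refine ⟨S ::ₘ F, ?_, fun e => ?_, fun e => ?_, fun U hU hex => ?_⟩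
      · simpa [hS] using hF
      · have h1 := hlo e
        have h2 := hle e
        rw [coverCount_cons, ← Finset.add_sum_erase _ _ hD']
        omega
      · have h1 := hhi e
        have h2 := hge e
        rw [coverCount_cons, ← Finset.add_sum_erase _ _ hD']
        rw [Multiset.count_zero] at h1
        split_ifs at h1 h2 ⊢ <;> omega
      · by_cases hU' : G.support D' ⊆ U
        · obtain ⟨e, he, hcount⟩ := hcov U hU' (by
            obtain ⟨D'', hD'', hdis⟩ := hex
            refine ⟨D'', ?_, hdis⟩
            have hne' : D'' ≠ D' := by
              rintro rfl
              exact not_sub _ (h𝓤 hD') U hdis hU'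
            rcases Finset.mem_insert.1 hD'' with h | h
            · exact Finset.mem_insert.2 (.inl h)
            · exact Finset.mem_insert_of_mem (Finset.mem_erase.2 ⟨hne', h⟩))
          exact ⟨e, he, by rw [coverCount_cons]; omega⟩
        · obtain ⟨e, heS, he⟩ := hcross U hU hU'
          exact ⟨e, he, one_le_coverCount (Multiset.mem_cons_self _ _) heS⟩
    · push Not at hu
      cases hw with
      | nil =>
        have h0 : 𝓤 = ∅ := by
          by_contra h
          obtain ⟨D', hD'⟩ := Finset.nonempty_iff_ne_empty.2 h
          obtain ⟨w, hw, hw'⟩ := hmeet D' hD'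
          rw [Finset.mem_singleton] at hw
          exact hu D' hD' (hw ▸ hw')
        subst h0
        have hDD₀ := hor.resolve_right (by simp)
        obtain ⟨S, hS, hle, hge, hcross⟩ := link D hD D₀ hD₀ hDD₀ pend c v hc hv hr
        refine ⟨{S}, by simpa using hS, fun e => ?_, fun e => ?_, fun U hU hex => ?_⟩
        · have h2 := hle e
          rw [← Multiset.cons_zero, coverCount_cons, coverCount_zero]
          simpa using h2
        · have h2 := hge e
          rw [← Multiset.cons_zero, coverCount_cons, coverCount_zero]
          simpa using h2
        · obtain ⟨D', hD', hdis⟩ := hex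
          simp only [insert_empty_eq, Finset.mem_singleton] at hD'
          subst hD'
          obtain ⟨e, heS, he⟩ := hcross U hU (not_sub _ hD₀ U hdis)
          exact ⟨e, he, one_le_coverCount (Multiset.mem_singleton_self _) heS⟩
      | @cons e _ w _ m A he hw =>
        have hr' : G.Reach (e ::ₘ pend).toFinset c w :=
          (hr.mono (by simp [Finset.subset_insert])).tail ⟨e, by simp, he⟩
        obtain ⟨F, hF, hlo, hhi, hcov⟩ := ih w m A hw D hD (e ::ₘ pend) c 𝓤 h𝓤 hD𝓤 hD₀𝓤 hc hr' hor
          (fun D' hD' => by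
            obtain ⟨z, hz, hz'⟩ := hmeet D' hD'
            refine ⟨z, (Finset.mem_insert.1 hz).resolve_left ?_, hz'⟩
            rintro rfl
            exact hu D' hD' hz')
          (by rw [Multiset.card_cons] at hcard; omega)
        refine ⟨F, hF, hlo, fun f => ?_, hcov⟩
        have h1 := hhi f
        rw [Multiset.count_cons] at h1 ⊢
        split_ifs at h1 ⊢ <;> omega

/-! ### Sides of bridges -/

theorem crossesB_iff {e : G.E} {a b : G.V} (h : G.ends e = s(a, b)) (U : Finset G.V) :
    G.crossesB U e = true ↔ ¬ (a ∈ U ↔ b ∈ U) := by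
  rw [crossesB_eq h]
  by_cases ha : a ∈ U <;> by_cases hb : b ∈ U <;> simp [ha, hb]

theorem crossesB_compl (e : G.E) (U : Finset G.V) : G.crossesB Uᶜ e = G.crossesB U e := by
  obtain ⟨a, b, hab⟩ := exists_ends e
  rw [Bool.eq_iff_iff, crossesB_iff hab, crossesB_iff hab, Finset.mem_compl, Finset.mem_compl]
  tauto

theorem boundary_compl (S : Finset G.E) (U : Finset G.V) : G.boundary S Uᶜ = G.boundary S U := by
  unfold boundary
  simp only [crossesB_compl]

theorem crossesB_iff_eq {U : Finset G.V} {b : G.E} (h : G.boundary Finset.univ U = {b}) (e : G.E) :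
    G.crossesB U e = true ↔ e = b := by
  rw [← Finset.mem_singleton (a := b), ← h, mem_boundary]
  simp

/-- `U` is one of the two sides of a bridge in `B_s(G)`. -/
def IsSide (U : Finset G.V) : Prop :=
  (∃ b, G.boundary Finset.univ U = {b}) ∧
    (∃ e, G.neg e = true ∧ ∀ v ∈ G.ends e, v ∈ U) ∧ ∃ e, G.neg e = true ∧ ∀ v ∈ G.ends e, v ∉ U

theorem IsSide.compl {U : Finset G.V} (h : IsSide U) : IsSide Uᶜ := by
  obtain ⟨⟨b, hb⟩, h1, h2⟩ := h
  refine ⟨⟨b, by rw [boundary_compl, hb]⟩, ?_, ?_⟩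
  · simpa using h2
  · simpa using h1

theorem IsSBridge.exists_side {b : G.E} (h : G.IsSBridge b) :
    ∃ U, G.boundary Finset.univ U = {b} ∧ IsSide U := by
  obtain ⟨⟨U, hU⟩, x, y, hxy, hx, hy⟩ := h
  have key : ∀ z, (G.negEdges (G.compEdges (Finset.univ.erase b) z)).Nonempty →
      ∃ e, G.neg e = true ∧ ∀ v ∈ G.ends e, (v ∈ U ↔ z ∈ U) := by
    rintro z ⟨e, he⟩
    rw [negEdges, Finset.mem_filter, compEdges, Finset.mem_filter] at he
    obtain ⟨⟨heb, u, hu, hr⟩, hn⟩ := he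
    refine ⟨e, hn, fun v hv => ?_⟩
    have h1 : u ∈ U ↔ z ∈ U := by
      by_contra hc
      obtain ⟨f, hf, hf'⟩ := reach_boundary hr (U := U) (fun h => hc h.symm)
      exact Finset.ne_of_mem_erase hf ((crossesB_iff_eq hU f).1 hf')
    obtain ⟨w, hw⟩ := Sym2.mem_iff_exists.1 hu
    have h2 := (crossesB_iff hw U).symm.trans (crossesB_iff_eq hU e)
    have h3 := Finset.ne_of_mem_erase heb
    rw [hw, Sym2.mem_iff] at hv
    rcases hv with rfl | rfl <;> tauto
  have hc := ((crossesB_iff hxy U).symm.trans (crossesB_iff_eq hU b)).2 rfl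
  obtain ⟨e₁, h1, h1'⟩ := key x hx
  obtain ⟨e₂, h2, h2'⟩ := key y hy
  refine ⟨U, hU, ⟨b, hU⟩, ?_⟩
  by_cases hxU : x ∈ U
  · exact ⟨⟨e₁, h1, fun v hv => (h1' v hv).2 hxU⟩,
      e₂, h2, fun v hv h => hc ⟨fun _ => (h2' v hv).1 h, fun _ => hxU⟩⟩
  · exact ⟨⟨e₂, h2, fun v hv => (h2' v hv).2 (by tauto)⟩,
      e₁, h1, fun v hv h => hxU ((h1' v hv).1 h)⟩

theorem disjoint_of_uncrossed (hG : ∀ u v, G.Reach Finset.univ u v) {W U : Finset G.V}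
    {b b' : G.E} (hW : G.boundary Finset.univ W = {b}) (hU : G.boundary Finset.univ U = {b'})
    (hb' : ∀ v ∈ G.ends b', v ∉ W) {p : G.V} (hp : p ∈ G.ends b) (hpW : p ∈ W) (hpU : p ∉ U) :
    Disjoint W U := by
  rw [Finset.disjoint_left]
  intro z hzW hzU
  obtain ⟨f, -, hf⟩ := reach_boundary (hG z p) (U := W ∩ U) (by simp [hzW, hzU, hpU])
  obtain ⟨x, y, hxy⟩ := exists_ends f
  rw [crossesB_iff hxy, Finset.mem_inter, Finset.mem_inter] at hf
  have h1 := (crossesB_iff hxy W).symm.trans (crossesB_iff_eq hW f)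
  have h2 := (crossesB_iff hxy U).symm.trans (crossesB_iff_eq hU f)
  by_cases hfb' : f = b'
  · subst hfb'
    have h3 := hb' x (by simp [hxy])
    have h4 := hb' y (by simp [hxy])
    tauto
  · have hfb : f = b := by tauto
    subst hfb
    rw [hxy, Sym2.mem_iff] at hp
    rcases hp with rfl | rfl <;> tauto

theorem disjoint_or_subset (hG : ∀ u v, G.Reach Finset.univ u v) {W U : Finset G.V}
    {b b' : G.E} (hW : G.boundary Finset.univ W = {b}) (hU : G.boundary Finset.univ U = {b'})
    (hb' : ∀ v ∈ G.ends b', v ∉ W) : Disjoint W U ∨ W ⊆ U := by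
  obtain ⟨x, y, hxy⟩ := exists_ends b
  have hc := ((crossesB_iff hxy W).symm.trans (crossesB_iff_eq hW b)).2 rfl
  obtain ⟨p, hp, hpW⟩ : ∃ p ∈ G.ends b, p ∈ W := by
    by_cases hx : x ∈ W
    · exact ⟨x, by simp [hxy], hx⟩
    · exact ⟨y, by simp [hxy], by tauto⟩
  by_cases hpU : p ∈ U
  · right
    have := disjoint_of_uncrossed hG hW (boundary_compl _ U ▸ hU) hb' hp hpW (by simpa using hpU)
    exact disjoint_compl_right_iff.1 this
  · exact .inl (disjoint_of_uncrossed hG hW hU hb' hp hpW hpU)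

theorem disjoint_of_minimal (hG : ∀ u v, G.Reach Finset.univ u v) {U U' : Finset G.V}
    (h : Minimal IsSide U) (h' : Minimal IsSide U') (hne : U ≠ U') : Disjoint U U' := by
  obtain ⟨b, hb⟩ := h.prop.1
  obtain ⟨b', hb'⟩ := h'.prop.1
  by_cases hbb : b = b'
  · subst hbb
    rw [Finset.disjoint_left]
    intro w hw hw'
    obtain ⟨z, hz⟩ : ∃ z, ¬ (z ∈ U ↔ z ∈ U') := by
      by_contra! hc
      exact hne (Finset.ext hc)
    obtain ⟨f, -, hf⟩ := reach_boundary (hG z w) (U := symmDiff U U') (by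
      rw [Finset.mem_symmDiff, Finset.mem_symmDiff]; tauto)
    obtain ⟨x, y, hxy⟩ := exists_ends f
    rw [crossesB_iff hxy, Finset.mem_symmDiff, Finset.mem_symmDiff] at hf
    have h1 := (crossesB_iff hxy U).symm.trans (crossesB_iff_eq hb f)
    have h2 := (crossesB_iff hxy U').symm.trans (crossesB_iff_eq hb' f)
    tauto
  · obtain ⟨x, y, hxy⟩ := exists_ends b'
    have h1 := ((crossesB_iff hxy U).symm.trans (crossesB_iff_eq hb b')).not.2 (Ne.symm hbb)
    rw [not_not] at h1
    by_cases hx : x ∈ U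
    · have hy := h1.1 hx
      rcases disjoint_or_subset hG (boundary_compl _ U ▸ hb) hb' (by
        simp [hxy, hx, hy]) with hd | hs
      · have hsub : U' ⊆ U := fun z hz => by
          by_contra hzU
          exact Finset.disjoint_left.1 hd (Finset.mem_compl.2 hzU) hz
        exact absurd (h.eq_of_le h'.prop hsub) (Ne.symm hne)
      · have hsub : U'ᶜ ⊆ U := fun z hz => by
          by_contra hzU
          exact Finset.mem_compl.1 hz (hs (Finset.mem_compl.2 hzU))
        have := h.eq_of_le h'.prop.compl hsub
        rw [← this]
        exact disjoint_compl_left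
    · have hy : y ∉ U := fun h => hx (h1.2 h)
      rcases disjoint_or_subset hG hb hb' (by simp [hxy, hx, hy]) with hd | hs
      · exact hd
      · exact absurd (h'.eq_of_le h.prop hs) hne

/-- Every vertex set containing a negative edge and bounded by a bridge contains an unbalanced
circuit. -/
theorem exists_circuit_in_side {T : Finset G.E} (hT : ∀ u v, G.Reach T u v)
    (hTn : ∀ e ∈ T, G.neg e = false) {U : Finset G.V} (hU : IsSide U) :
    ∃ C, G.IsUnbalancedCircuit C ∧ G.support C ⊆ U := by
  obtain ⟨⟨b, hb⟩, ⟨e, he, heU⟩, -⟩ := hU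
  have heT : e ∉ T := fun h => by simp [hTn e h] at he
  obtain ⟨J, hJ, hpar⟩ := exists_even_extension hT (Finset.disjoint_singleton_left.2 heT)
  obtain ⟨C, hCs, heC, hC⟩ := exists_circuit_through hpar (e := e) (by simp)
  refine ⟨C, ⟨hC, ?_⟩, ?_⟩
  · have : G.negEdges C = {e} := by
      ext f
      simp only [negEdges, Finset.mem_filter, Finset.mem_singleton]
      constructor
      · rintro ⟨hf, hfn⟩
        rcases Finset.mem_union.1 (hCs hf) with h | h
        · exact Finset.mem_singleton.1 h
        · simp [hTn f (hJ h)] at hfn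
      · rintro rfl
        exact ⟨heC, he⟩
    simp [this]
  · obtain ⟨x, y, hxy⟩ := exists_ends e
    exact (hC.side hb).resolve_right fun h =>
      Finset.disjoint_left.1 h (mem_support.2 ⟨e, heC, by simp [hxy]⟩) (heU x (by simp [hxy]))

theorem disjoint_of_support {A B : Finset G.E} (h : Disjoint (G.support A) (G.support B)) :
    Disjoint A B := by
  rw [Finset.disjoint_left]
  intro e hA hB
  obtain ⟨a, b, hab⟩ := exists_ends e
  have ha : a ∈ G.ends e := by simp [hab]
  exact Finset.disjoint_left.1 h (mem_support.2 ⟨e, hA, ha⟩) (mem_support.2 ⟨e, hB, ha⟩)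

/-- A family of edge-disjoint unbalanced circuits extends by circuits `𝒞` so that every side of a
bridge of `B_s(G)` contains a member. -/
theorem exists_terminals {T : Finset G.E} (hT : ∀ u v, G.Reach T u v)
    (hTn : ∀ e ∈ T, G.neg e = false) {ℛ : Finset (Finset G.E)}
    (hu : ∀ D ∈ ℛ, G.IsUnbalancedCircuit D)
    (hd : ∀ D ∈ ℛ, ∀ D' ∈ ℛ, D ≠ D' → Disjoint D D')
    (hm : ∀ D ∈ ℛ, ∀ D' ∈ ℛ, D ≠ D' → (G.support D ∩ G.support D').card ≤ 1) :
    ∃ 𝒞 : Finset (Finset G.E), (∀ D ∈ ℛ ∪ 𝒞, G.IsUnbalancedCircuit D) ∧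
      (∀ D ∈ ℛ ∪ 𝒞, ∀ D' ∈ ℛ ∪ 𝒞, D ≠ D' → Disjoint D D') ∧
      (∀ D ∈ ℛ ∪ 𝒞, ∀ D' ∈ ℛ ∪ 𝒞, D ≠ D' → ∀ (Q : Finset G.E) (c c' : G.V),
        c ∈ G.support D → c' ∈ G.support D' → G.Reach Q c c' →
        ∃ S, G.IsSignedCircuit S ∧ G.ConnOn S ∧ D ⊆ S ∧ D' ⊆ S ∧ ∀ e ∈ S, e ∈ D ∨ e ∈ D' ∨
          (e ∈ Q ∧ ¬ (G.ends e).IsDiag ∧ ∀ C ∈ 𝒞, e ∉ C)) ∧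
      ∀ U, IsSide U → ∃ D ∈ ℛ ∪ 𝒞, G.support D ⊆ U := by
  have hG : ∀ u v, G.Reach Finset.univ u v := fun u v => (hT u v).mono (Finset.subset_univ _)
  have hex : ∀ U : Finset G.V, ∃ C, IsSide U → G.IsUnbalancedCircuit C ∧ G.support C ⊆ U := by
    intro U
    by_cases h : IsSide U
    · obtain ⟨C, hC⟩ := exists_circuit_in_side hT hTn h
      exact ⟨C, fun _ => hC⟩
    · exact ⟨∅, fun h' => absurd h' h⟩
  choose c hc using hex
  let 𝓜 : Finset (Finset G.V) := Finset.univ.filter fun U =>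
    Minimal IsSide U ∧ ∀ D ∈ ℛ, ¬ G.support D ⊆ U
  have hM : ∀ U ∈ 𝓜, Minimal IsSide U ∧ ∀ D ∈ ℛ, ¬ G.support D ⊆ U := fun U hU =>
    (Finset.mem_filter.1 hU).2
  have hcircuit : ∀ U ∈ 𝓜, G.IsUnbalancedCircuit (c U) ∧ G.support (c U) ⊆ U := fun U hU =>
    hc U (hM U hU).1.prop
  have hmem : ∀ D ∈ ℛ ∪ 𝓜.image c, D ∈ ℛ ∨ ∃ U ∈ 𝓜, c U = D := fun D hD => by
    simpa using hD
  have hun : ∀ D ∈ ℛ ∪ 𝓜.image c, G.IsUnbalancedCircuit D := by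
    intro D hD
    rcases hmem D hD with h | ⟨U, hU, rfl⟩
    exacts [hu D h, (hcircuit U hU).1]
  have hdis : ∀ U ∈ 𝓜, ∀ D ∈ ℛ ∪ 𝓜.image c, D ≠ c U → Disjoint (G.support D) U := by
    intro U hU D hD hne
    rcases hmem D hD with h | ⟨U', hU', rfl⟩
    · obtain ⟨b, hb⟩ := (hM U hU).1.prop.1
      exact ((hu D h).1.side hb).resolve_left ((hM U hU).2 D h)
    · exact (disjoint_of_minimal hG (hM U' hU').1 (hM U hU).1 (fun h => hne (h ▸ rfl))).mono_left
        (hcircuit U' hU').2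
  have hdis' : ∀ U ∈ 𝓜, ∀ D ∈ ℛ ∪ 𝓜.image c, D ≠ c U →
      Disjoint (G.support D) (G.support (c U)) := fun U hU D hD hne =>
    (hdis U hU D hD hne).mono_right (hcircuit U hU).2
  have hpair : ∀ D ∈ ℛ ∪ 𝓜.image c, ∀ D' ∈ ℛ ∪ 𝓜.image c, D ≠ D' →
      Disjoint D D' ∧ (G.support D ∩ G.support D').card ≤ 1 := by
    intro D hD D' hD' hne
    rcases hmem D' hD' with h' | ⟨U, hU, rfl⟩
    · rcases hmem D hD with h | ⟨U, hU, rfl⟩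
      · exact ⟨hd D h D' h' hne, hm D h D' h' hne⟩
      · have := (hdis' U hU D' hD' hne.symm).symm
        exact ⟨disjoint_of_support this, by
          rw [Finset.disjoint_iff_inter_eq_empty.1 this]; simp⟩
    · have := hdis' U hU D hD hne
      exact ⟨disjoint_of_support this, by
        rw [Finset.disjoint_iff_inter_eq_empty.1 this]; simp⟩
  refine ⟨𝓜.image c, hun, fun D hD D' hD' hne => (hpair D hD D' hD' hne).1, ?_, ?_⟩
  · intro D hD D' hD' hne Q x x' hx hx' hr
    obtain ⟨S, hS, hconn, h1, h2, h3⟩ := exists_barbell (hun D hD) (hun D' hD')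
      (hpair D hD D' hD' hne).1 (hpair D hD D' hD' hne).2 hx hx' hr
    refine ⟨S, hS, hconn, h1, h2, fun e he => ?_⟩
    rcases h3 e he with h | h | ⟨hQ, hdiag, h⟩
    · exact .inl h
    · exact .inr (.inl h)
    by_cases heD : e ∈ D
    · exact .inl heD
    by_cases heD' : e ∈ D'
    · exact .inr (.inl heD')
    refine .inr (.inr ⟨hQ, hdiag, fun C hC heC => ?_⟩)
    obtain ⟨U, hU, rfl⟩ := Finset.mem_image.1 hC
    obtain ⟨b, hb⟩ := (hM U hU).1.prop.1
    obtain ⟨v, hv, hvU⟩ := h U b hb (hdis U hU D hD fun h => heD (h ▸ heC))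
      (hdis U hU D' hD' fun h => heD' (h ▸ heC))
    exact hvU ((hcircuit U hU).2 (mem_support.2 ⟨e, heC, hv⟩))
  · intro U hU
    obtain ⟨W, hWU, hW⟩ := exists_minimal_le_of_wellFoundedLT IsSide U hU
    by_cases h : ∃ D ∈ ℛ, G.support D ⊆ W
    · obtain ⟨D, hD, hDW⟩ := h
      exact ⟨D, Finset.mem_union_left _ hD, hDW.trans hWU⟩
    · push Not at h
      have hWM : W ∈ 𝓜 := Finset.mem_filter.2 ⟨Finset.mem_univ _, hW, h⟩
      exact ⟨c W, Finset.mem_union_right _ (Finset.mem_image_of_mem c hWM),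
        (hcircuit W hWM).2.trans hWU⟩

/-! ### Assembling the cover -/

theorem IsCircuit.mem_of_isTwoEdgeCut {C : Finset G.E} (hC : G.IsCircuit C) {e f : G.E}
    (he : e ∈ C) (h : G.IsTwoEdgeCut e f) : f ∈ C := by
  obtain ⟨hne, U, hU⟩ := h
  have hmem : ∀ g, G.crossesB U g = true ↔ g = e ∨ g = f := fun g => by
    have : g ∈ G.boundary Finset.univ U ↔ g ∈ ({e, f} : Finset G.E) := by rw [hU]
    simpa [mem_boundary] using this
  by_contra hf
  have hb : G.boundary C U = {e} := by
    ext g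
    rw [mem_boundary, hmem, Finset.mem_singleton]
    constructor
    · rintro ⟨hg, rfl | rfl⟩
      exacts [rfl, absurd hg hf]
    · rintro rfl
      exact ⟨he, .inl rfl⟩
  have := hC.even_boundary U
  rw [hb] at this
  simp at this

theorem coverCount_SSet {F : Multiset (Finset G.E)} {e : G.E}
    (h : ∃ C, G.IsCircuit C ∧ e ∈ C ∧ ∀ f ∈ C, 1 ≤ G.coverCount F f) :
    ∀ f ∈ G.SSet e, 1 ≤ G.coverCount F f := by
  obtain ⟨C, hC, he, hcov⟩ := h
  intro f hf
  refine hcov f ?_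
  rcases Finset.mem_insert.1 hf with rfl | hf
  · exact he
  · exact hC.mem_of_isTwoEdgeCut he (Finset.mem_filter.1 hf).2

theorem Decomposes.loop_mem {ℬ ℛ : Finset (Finset G.E)} {Z : Finset G.E} (h : Decomposes ℬ ℛ Z)
    {e : G.E} (he : e ∈ Z) (hn : G.neg e = true) (hd : (G.ends e).IsDiag) : {e} ∈ ℛ := by
  rcases (h.mem_iff e).1 he with ⟨B, hB, heB⟩ | ⟨D, hD, heD⟩
  · have h1 := h.balanced B hB
    rw [h1.1.eq_loop heB hd] at h1
    have h2 : G.negEdges {e} = {e} := by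
      ext f
      simp only [negEdges, Finset.mem_filter, Finset.mem_singleton, and_iff_left_iff_imp]
      rintro rfl
      exact hn
    have h3 := h1.2
    rw [h2] at h3
    simp at h3
  · rwa [← (h.unbalanced D hD).1.eq_loop heD hd]

theorem sum_ind_le_one {𝒞 : Finset (Finset G.E)}
    (h : ∀ C ∈ 𝒞, ∀ C' ∈ 𝒞, C ≠ C' → Disjoint C C') (e : G.E) : ∑ C ∈ 𝒞, ind C e ≤ 1 := by
  rw [sum_ind h]
  exact ind_le_one _ _

theorem sum_ind_eq_one {𝒞 : Finset (Finset G.E)}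
    (h : ∀ C ∈ 𝒞, ∀ C' ∈ 𝒞, C ≠ C' → Disjoint C C') {C : Finset G.E} (hC : C ∈ 𝒞) {e : G.E}
    (he : e ∈ C) : ∑ C ∈ 𝒞, ind C e = 1 := by
  rw [sum_ind h]
  exact ind_of_mem (Finset.mem_biUnion.2 ⟨C, hC, he⟩)

theorem sum_ind_eq_zero {𝒞 : Finset (Finset G.E)} {e : G.E} (h : ¬ ∃ C ∈ 𝒞, e ∈ C) :
    ∑ C ∈ 𝒞, ind C e = 0 :=
  Finset.sum_eq_zero fun C hC => ind_of_notMem fun he => h ⟨C, hC, he⟩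

/-- The cover obtained from a tour when there are at least two terminals. -/
theorem exists_cover_of_terminals {T Z : Finset G.E} {ℬ ℛ 𝒞 : Finset (Finset G.E)}
    (hT : ∀ u v, G.Reach T u v) (h : Decomposes ℬ ℛ Z)
    (hun : ∀ D ∈ ℛ ∪ 𝒞, G.IsUnbalancedCircuit D)
    (hdis : ∀ D ∈ ℛ ∪ 𝒞, ∀ D' ∈ ℛ ∪ 𝒞, D ≠ D' → Disjoint D D')
    (hlink : ∀ D ∈ ℛ ∪ 𝒞, ∀ D' ∈ ℛ ∪ 𝒞, D ≠ D' → ∀ (Q : Finset G.E) (c c' : G.V),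
      c ∈ G.support D → c' ∈ G.support D' → G.Reach Q c c' →
      ∃ S, G.IsSignedCircuit S ∧ G.ConnOn S ∧ D ⊆ S ∧ D' ⊆ S ∧ ∀ e ∈ S, e ∈ D ∨ e ∈ D' ∨
        (e ∈ Q ∧ ¬ (G.ends e).IsDiag ∧ ∀ C ∈ 𝒞, e ∉ C))
    (hside : ∀ U, IsSide U → ∃ D ∈ ℛ ∪ 𝒞, G.support D ⊆ U)
    (hcard : 2 ≤ (ℛ ∪ 𝒞).card) :
    ∃ F : Multiset (Finset G.E), (∀ S ∈ F, G.IsSignedCircuit S) ∧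
      (∀ e, G.coverCount F e ≤ 3) ∧ (∀ b, G.IsSBridge b → 1 ≤ G.coverCount F b) ∧
      (∀ e ∈ Z, ∃ C, G.IsCircuit C ∧ e ∈ C ∧ ∀ f ∈ C, 1 ≤ G.coverCount F f) ∧
      ∀ e ∈ Z, G.neg e = true → (G.ends e).IsDiag → G.coverCount F e = 2 := by
  obtain ⟨D₀, hD₀⟩ : (ℛ ∪ 𝒞).Nonempty := Finset.card_pos.1 (by omega)
  have hne : ∀ D ∈ ℛ ∪ 𝒞, (G.support D).Nonempty := fun D hD => (hun D hD).1.support_nonempty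
  obtain ⟨x₀, hx₀⟩ := hne D₀ hD₀
  obtain ⟨m, hw, hm⟩ := exists_tour hT (fun D hD => (h.unbalanced D hD).1) h.disj_right x₀
  obtain ⟨F, hF, hlo, hhi, hcov⟩ := exists_chain hne hdis hlink hD₀ hx₀ _ x₀ m _ hw D₀ hD₀ 0 x₀
    ((ℛ ∪ 𝒞).erase D₀) (Finset.erase_subset _ _) (Finset.notMem_erase _ _)
    (Finset.notMem_erase _ _) hx₀ .refl
    (.inr (Finset.card_pos.1 (by rw [Finset.card_erase_of_mem hD₀]; omega)))
    (fun D hD => by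
      obtain ⟨w, hw⟩ := hne D (Finset.mem_of_mem_erase hD)
      exact ⟨w, Finset.mem_univ w, hw⟩) (Nat.lt_succ_self _)
  have hsum : ∀ e, ind D₀ e + ind D₀ e + 2 * ∑ D ∈ (ℛ ∪ 𝒞).erase D₀, ind D e =
      2 * ∑ D ∈ ℛ ∪ 𝒞, ind D e := fun e => by
    rw [← Finset.add_sum_erase _ _ hD₀]; ring
  simp only [hsum, Multiset.count_zero, zero_add] at hlo hhi
  have hℛ : ∀ D ∈ ℛ, D ∈ ℛ ∪ 𝒞 := fun D => Finset.mem_union_left _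
  have hcount : ∀ e, G.coverCount (ℬ.val + F) e = ∑ B ∈ ℬ, ind B e + G.coverCount F e :=
    fun e => by rw [coverCount_add, coverCount_val]
  have hℬ0 : ∀ D ∈ ℛ, ∀ e ∈ D, ∑ B ∈ ℬ, ind B e = 0 := fun D hD e he =>
    sum_ind_eq_zero fun ⟨B, hB, heB⟩ => Finset.disjoint_left.1 (h.disj B hB D hD) heB he
  refine ⟨ℬ.val + F, fun S hS => ?_, fun e => ?_, fun b hb => ?_, fun e he => ?_,
    fun e he hn hd => ?_⟩
  · rcases Multiset.mem_add.1 hS with hS | hS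
    exacts [.inl (h.balanced S hS), hF S hS]
  · have h1 := hhi e
    have h2 := hm e
    have h3 := sum_ind_le_one h.disj_left e
    have h4 := sum_ind_le_one hdis e
    have h5 := ind_le_one T e
    rw [hcount]
    by_cases heR : ∃ D ∈ ℛ, e ∈ D
    · rw [if_pos heR] at h2
      obtain ⟨D, hD, heD⟩ := heR
      have := hℬ0 D hD e heD
      split_ifs at h1 <;> omega
    · rw [if_neg heR] at h2
      by_cases heC : ∃ C ∈ 𝒞, e ∈ C
      · obtain ⟨C, hC, heC⟩ := heC
        rw [if_neg fun hg => hg.2 C hC heC] at h1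
        omega
      · have h6 : ∑ D ∈ ℛ ∪ 𝒞, ind D e = 0 := sum_ind_eq_zero fun ⟨D, hD, heD⟩ =>
          (Finset.mem_union.1 hD).elim (fun hD => heR ⟨D, hD, heD⟩) fun hD => heC ⟨D, hD, heD⟩
        split_ifs at h1 <;> omega
  · obtain ⟨U, hU, hUs⟩ := hb.exists_side
    have key : ∀ W, IsSide W → G.boundary Finset.univ W = {b} → G.support D₀ ⊆ W →
        1 ≤ G.coverCount (ℬ.val + F) b := by
      intro W hW hWb hDW
      obtain ⟨D, hD, hDs⟩ := hside _ hW.compl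
      have hdisj : Disjoint (G.support D) W :=
        (disjoint_compl_left (a := W)).mono_left hDs
      obtain ⟨e, he, hc⟩ := hcov W hDW ⟨D, by
        by_cases hDD : D = D₀
        · exact Finset.mem_insert.2 (.inl hDD)
        · exact Finset.mem_insert_of_mem (Finset.mem_erase.2 ⟨hDD, hD⟩), hdisj⟩
      rw [hWb, Finset.mem_singleton] at he
      subst he
      rw [hcount]
      omega
    rcases (hun D₀ hD₀).1.side hU with hs | hs
    · exact key U hUs hU hs
    · refine key Uᶜ hUs.compl (by rw [boundary_compl, hU]) fun z hz => ?_
      exact Finset.mem_compl.2 (Finset.disjoint_left.1 hs hz)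
  · rcases (h.mem_iff e).1 he with ⟨B, hB, heB⟩ | ⟨D, hD, heD⟩
    · exact ⟨B, (h.balanced B hB).1, heB, fun f hf =>
        one_le_coverCount (Multiset.mem_add.2 (.inl hB)) hf⟩
    · refine ⟨D, (h.unbalanced D hD).1, heD, fun f hf => ?_⟩
      have h2 := hlo f
      rw [sum_ind_eq_one hdis (hℛ D hD) hf] at h2
      rw [hcount]
      omega
  · have hl := h.loop_mem he hn hd
    have hl' : e ∈ ({e} : Finset G.E) := Finset.mem_singleton_self e
    have h1 := hhi e
    have h2 := hlo e
    rw [if_neg fun hg => hg.1 hd] at h1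
    rw [sum_ind_eq_one hdis (hℛ _ hl) hl'] at h1 h2
    rw [hcount, hℬ0 _ hl e hl']
    omega

/-- The cover when the decomposition has at most one unbalanced circuit. -/
theorem exists_cover_of_no_bridge [Nonempty G.V] {T : Finset G.E} (hT : ∀ u v, G.Reach T u v)
    (hTn : ∀ e ∈ T, G.neg e = false) (hn : 2 ≤ (G.negEdges Finset.univ).card) {Z : Finset G.E}
    {ℬ ℛ : Finset (Finset G.E)} (hZ : G.negEdges Finset.univ ⊆ Z) (h : Decomposes ℬ ℛ Z) (hcard : ℛ.card ≤ 1) :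
    ∃ F : Multiset (Finset G.E), (∀ S ∈ F, G.IsSignedCircuit S) ∧
      (∀ e, G.coverCount F e ≤ 3) ∧
      (∀ e ∈ G.negEdges Finset.univ, ∃ S ∈ F, ∃ C ⊆ S, G.IsCircuit C ∧ e ∈ C) ∧
      ∀ e, G.neg e = true → (G.ends e).IsDiag → G.coverCount F e = 2 := by
  have hN : ∀ e, e ∈ G.negEdges Finset.univ ↔ G.neg e = true := fun e => by simp [negEdges]
  by_cases hl : ∃ e, G.neg e = true ∧ (G.ends e).IsDiag
  · obtain ⟨l, hln, hld⟩ := hl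
    have hlR := h.loop_mem (hZ ((hN l).2 hln)) hln hld
    have hR : ∀ D ∈ ℛ, D = {l} := fun D hD => Finset.card_le_one.1 hcard D hD _ hlR
    obtain ⟨e', he', hne⟩ := Finset.exists_mem_ne hn l
    obtain ⟨S, hS, -, C, hCS, hC, hlC⟩ := exists_signed_through hT hTn hln ((hN e').1 he') hne.symm
    refine ⟨S ::ₘ S ::ₘ ℬ.val, ?_, fun e => ?_, fun e he => ?_, fun e he hd => ?_⟩
    · simp only [Multiset.mem_cons, forall_eq_or_imp, hS, true_and]
      exact fun B hB => .inl (h.balanced B hB)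
    · have h1 := ind_le_one S e
      have h2 := sum_ind_le_one h.disj_left e
      rw [coverCount_cons, coverCount_cons, coverCount_val]
      omega
    · rcases (h.mem_iff e).1 (hZ he) with ⟨B, hB, heB⟩ | ⟨D, hD, heD⟩
      · exact ⟨B, by simp [hB], B, subset_rfl, (h.balanced B hB).1, heB⟩
      · rw [hR D hD, Finset.mem_singleton] at heD
        subst heD
        exact ⟨S, by simp, C, hCS, hC, hlC⟩
    · have hel : e = l := by
        have := hR _ (h.loop_mem (hZ ((hN e).2 he)) he hd)
        simpa using this
      subst hel
      have h2 := sum_ind_eq_zero (𝒞 := ℬ) (e := e) fun ⟨B, hB, heB⟩ =>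
        Finset.disjoint_left.1 (h.disj B hB _ hlR) heB (by simp)
      rw [coverCount_cons, coverCount_cons, coverCount_val, h2, ind_of_mem (hCS hlC)]
  have hl' : ∀ F : Multiset (Finset G.E), ∀ e, G.neg e = true → (G.ends e).IsDiag →
      G.coverCount F e = 2 := fun F e he hd => absurd ⟨e, he, hd⟩ hl
  by_cases hev : Even (G.negEdges Finset.univ).card
  · obtain ⟨F, hF, hc, hF'⟩ := exists_cover_of_even hT hTn (fun e => (hN e).1) hev
    refine ⟨F, hF, fun e => (hc e).trans ?_, hF', hl' F⟩
    have h1 := ind_le_one (G.negEdges Finset.univ) e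
    have h2 := ind_le_one T e
    omega
  · obtain ⟨e₁, he₁, e₂, he₂, hne⟩ := Finset.one_lt_card.1 hn
    obtain ⟨S, hS, -, C, hCS, hC, heC⟩ :=
      exists_signed_through hT hTn ((hN e₁).1 he₁) ((hN e₂).1 he₂) hne
    obtain ⟨F, hF, hc, hF'⟩ := exists_cover_of_even hT hTn
      (X := (G.negEdges Finset.univ).erase e₁) (fun e he => (hN e).1 (Finset.mem_of_mem_erase he))
      (by
        have := Finset.card_erase_add_one he₁
        rw [← this, Nat.even_add_one, not_not] at hev
        exact hev)
    refine ⟨S ::ₘ F, ?_, fun e => ?_, fun e he => ?_, hl' _⟩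
    · simpa [hS] using hF
    · have h1 := ind_le_one S e
      have h2 := hc e
      have h3 : ind ((G.negEdges Finset.univ).erase e₁) e + ind T e ≤ 1 := by
        rw [← ind_union]
        · exact ind_le_one _ _
        · refine Finset.disjoint_left.2 fun f hf hfT => ?_
          have := (hN f).1 (Finset.mem_of_mem_erase hf)
          simp [hTn f hfT] at this
      have h4 := ind_le_one T e
      rw [coverCount_cons]
      omega
    · by_cases h1 : e = e₁
      · subst h1
        exact ⟨S, by simp, C, hCS, hC, heC⟩
      · obtain ⟨S', hS', h'⟩ := hF' e (Finset.mem_erase.2 ⟨h1, he⟩)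
        exact ⟨S', by simp [hS'], h'⟩

end SignedMultigraph

/-- Let `H` be a signed graph with `|E_N(H)| ≥ 2` such that
`H − E_N(H)` is a spanning tree of `H`. Then `H` has a signed circuit
`{0,1,2,3}`-cover covering each edge of `B_s(H) ∪ (⋃_{e ∈ E_N(H)} S_H(e))`
at least once, and covering each negative loop exactly twice. -/
theorem cover_0123_exists (G : SignedMultigraph)
    (hn : 2 ≤ (G.negEdges Finset.univ).card)
    (htree : G.IsSpanningTree (Finset.univ \ G.negEdges Finset.univ)) :
    ∃ F : Multiset (Finset G.E),
      (∀ S ∈ F, G.IsSignedCircuit S) ∧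
      (∀ e : G.E, G.coverCount F e ≤ 3) ∧
      (∀ b : G.E, G.IsSBridge b → 1 ≤ G.coverCount F b) ∧
      (∀ e ∈ G.negEdges Finset.univ, ∀ f ∈ G.SSet e, 1 ≤ G.coverCount F f) ∧
      (∀ e : G.E, G.neg e = true → (G.ends e).IsDiag → G.coverCount F e = 2) := by
  set N := G.negEdges Finset.univ with hN
  have hNmem : ∀ e, e ∈ N ↔ G.neg e = true := fun e => by simp [hN, SignedMultigraph.negEdges]
  obtain ⟨-, hV, hT⟩ := htree
  have hTn : ∀ e ∈ Finset.univ \ N, G.neg e = false := fun e he => by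
    simpa [hNmem] using he
  obtain ⟨J, hJ, hpar⟩ := SignedMultigraph.exists_even_extension hT Finset.disjoint_sdiff
  obtain ⟨ℬ, ℛ, h⟩ := SignedMultigraph.exists_decomposes _ hpar
  obtain ⟨𝒞, hun, hdis, hlink, hside⟩ :=
    SignedMultigraph.exists_terminals hT hTn h.unbalanced h.disj_right h.meet
  have hNZ : N ⊆ N ∪ J := Finset.subset_union_left
  by_cases hcard : 2 ≤ (ℛ ∪ 𝒞).card
  · obtain ⟨F, hF, hle, hb, hcov, hloop⟩ :=
      SignedMultigraph.exists_cover_of_terminals hT h hun hdis hlink hside hcard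
    exact ⟨F, hF, hle, hb, fun e he => SignedMultigraph.coverCount_SSet (hcov e (hNZ he)),
      fun e he hd => hloop e (hNZ ((hNmem e).2 he)) he hd⟩
  · obtain ⟨F, hF, hle, hcov, hloop⟩ := SignedMultigraph.exists_cover_of_no_bridge hT hTn hn hNZ h
      ((Finset.card_le_card Finset.subset_union_left).trans (by omega : (ℛ ∪ 𝒞).card ≤ 1))
    refine ⟨F, hF, hle, fun b hb => ?_, fun e he => ?_, hloop⟩
    · obtain ⟨U, -, hU⟩ := hb.exists_side
      obtain ⟨D, hD, hDU⟩ := hside U hU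
      obtain ⟨D', hD', hDU'⟩ := hside _ hU.compl
      have hDD : D = D' := Finset.card_le_one.1 (by omega) D hD D' hD'
      obtain ⟨z, hz⟩ := (hun D hD).1.support_nonempty
      exact absurd (hDU hz) (Finset.mem_compl.1 (hDU' (hDD ▸ hz)))
    · obtain ⟨S, hS, C, hCS, hC, heC⟩ := hcov e he
      exact SignedMultigraph.coverCount_SSet
        ⟨C, hC, heC, fun f hf => SignedMultigraph.one_le_coverCount hS (hCS hf)⟩
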